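/- arXiv:0706.1738 — 2 statements merged into one kernel-verified Lean document; each statement's English description precedes it below -/
import Mathlib

section
/- Let n be a positive integer and J a proper subset of [n−1]. Let D_0^J(n) be the set of derangements σ of [n] with DES σ = J, and D_1^J(n) the set of permutations σ of [n] with DES σ = J and exactly one fixed point. Then there exists a polynomial Q(s) with nonnegative integer coefficients such that Σ_{σ∈D_0^J(n)} s^{exc σ} − Σ_{σ∈D_1^J(n)} s^{exc σ} = (s − 1)·Q(s) in ℤ[s]. -/
/-- The value of a permutation of `[n] = {1, …, n}` at `i`, in 1-based terms:
for `1 ≤ i ≤ n` this is `σ(i) ∈ {1, …, n}`; outside `[n]` we return `i`. -/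
def permToFun {n : ℕ} (σ : Equiv.Perm (Fin n)) (i : ℕ) : ℕ :=
  if h : 1 ≤ i ∧ i ≤ n then ((σ ⟨i - 1, by omega⟩ : Fin n) : ℕ) + 1 else i

/-- `fix σ`: the number of fixed points of a permutation of `[n]`. -/
def fixCount {n : ℕ} (σ : Equiv.Perm (Fin n)) : ℕ :=
  ((Finset.Icc 1 n).filter fun i => permToFun σ i = i).card

/-- `exc σ`: the number of excedances of a permutation of `[n]`. -/
def excCount {n : ℕ} (σ : Equiv.Perm (Fin n)) : ℕ :=
  ((Finset.Icc 1 n).filter fun i => i < permToFun σ i).card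

/-- `DES σ`: the descent set of a permutation of `[n]`, a subset of `[n-1]`. -/
def desSet {n : ℕ} (σ : Equiv.Perm (Fin n)) : Finset ℕ :=
  (Finset.Icc 1 (n - 1)).filter fun i => permToFun σ (i + 1) < permToFun σ i

/-- The larger element of the first ascent of a list (its last element if there is none). -/
def hookTop : List ℕ → ℕ
  | [] => 0
  | [z] => z
  | z :: z' :: l => if z < z' then z' else hookTop (z' :: l)

/-- The weight of a list cut greedily into hooks, a hook being a weakly decreasing list
followed by an ascent to its top; each entry of a hook below the top contributes `s`. The weight
vanishes if the list is not a concatenation of hooks. -/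
def hookWt {R : Type*} [CommRing R] (s : R) : List ℕ → R
  | [] => 1
  | [_] => 0
  | z :: z' :: l =>
    if z < z' then s * hookWt s l
    else (if z < hookTop (z' :: l) then s else 1) * hookWt s (z' :: l)

theorem hookTop_map {α : Type*} (f g : α → ℕ) :
    ∀ l : List α, l ≠ [] → l.Pairwise (fun a b => f a < f b ↔ g a < g b) →
      ∃ a ∈ l, hookTop (l.map f) = f a ∧ hookTop (l.map g) = g a
  | [], h, _ => absurd rfl h
  | [z], _, _ => ⟨z, by simp, by simp [hookTop], by simp [hookTop]⟩
  | z :: z' :: l, _, hp => by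
    have hz : f z < f z' ↔ g z < g z' := (List.pairwise_cons.1 hp).1 z' (by simp)
    obtain ⟨a, ha, h1, h2⟩ := hookTop_map f g (z' :: l) (by simp) (List.pairwise_cons.1 hp).2
    simp only [List.map_cons] at h1 h2
    by_cases h : f z < f z'
    · exact ⟨z', by simp, by simp [hookTop, h], by simp [hookTop, hz.1 h]⟩
    · exact ⟨a, List.mem_cons_of_mem _ ha, by simp [hookTop, h, h1],
        by simp [hookTop, mt hz.2 h, h2]⟩

theorem hookWt_map {R : Type*} [CommRing R] (s : R) {α : Type*} (f g : α → ℕ) :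
    ∀ l : List α, l.Pairwise (fun a b => f a < f b ↔ g a < g b) →
      hookWt s (l.map f) = hookWt s (l.map g)
  | [], _ => by simp [hookWt]
  | [z], _ => by simp [hookWt]
  | z :: z' :: l, hp => by
    have hz := (List.pairwise_cons.1 hp).1
    have hp' := (List.pairwise_cons.1 hp).2
    have h1 := hookWt_map s f g l (List.pairwise_cons.1 hp').2
    have h2 := hookWt_map s f g (z' :: l) hp'
    obtain ⟨a, ha, h3, h4⟩ := hookTop_map f g (z' :: l) (by simp) hp'
    simp only [List.map_cons] at h2 h3 h4
    simp only [List.map_cons, hookWt, h1, h2, h3, h4, hz z' (by simp), hz a ha]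

theorem hookWt_eq_zero_or_pow {R : Type*} [CommRing R] (s : R) :
    ∀ l : List ℕ, hookWt s l = 0 ∨ ∃ k : ℕ, hookWt s l = s ^ k
  | [] => .inr ⟨0, by simp [hookWt]⟩
  | [_] => .inl (by simp [hookWt])
  | z :: z' :: l => by
    rw [hookWt]
    split_ifs
    · obtain h | ⟨k, h⟩ := hookWt_eq_zero_or_pow s l
      · exact .inl (by simp [h])
      · exact .inr ⟨k + 1, by rw [h, pow_succ']⟩
    · obtain h | ⟨k, h⟩ := hookWt_eq_zero_or_pow s (z' :: l)
      · exact .inl (by simp [h])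
      · exact .inr ⟨k + 1, by rw [h, pow_succ']⟩
    · obtain h | ⟨k, h⟩ := hookWt_eq_zero_or_pow s (z' :: l)
      · exact .inl (by simp [h])
      · exact .inr ⟨k, by rw [h, one_mul]⟩

/-- Adding an element in front of a list without making it increasing can only raise the
exponent of the hook weight. -/
theorem hookWt_cons_eq_pow {R : Type*} [CommRing R] (s : R) :
    ∀ (z : ℕ) (l : List ℕ), ¬ (z :: l).IsChain (· < ·) →
      (hookWt s (z :: l) = 0 ∧ hookWt s l = 0) ∨
      ∃ a b : ℕ, hookWt s (z :: l) = s ^ (a + b) ∧ hookWt s l = s ^ b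
  | z, [], h => by simp at h
  | z, z' :: l, h => by
    by_cases hz : z < z'
    · match l, h with
      | [], h => simp [hz] at h
      | z'' :: l, h =>
        simp only [List.isChain_cons_cons, hz, true_and] at h
        by_cases hz' : z' < z''
        · simp only [hz', true_and] at h
          simp only [hookWt, hz, hz', if_true]
          obtain ⟨h1, h2⟩ | ⟨a, b, h1, h2⟩ := hookWt_cons_eq_pow s z'' l h
          · exact .inl ⟨by simp [h1], by simp [h2]⟩
          · exact .inr ⟨a, b + 1, by rw [h1, ← pow_succ', add_assoc], by rw [h2, pow_succ']⟩
        · simp only [hookWt, hz, hz', if_true, if_false]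
          obtain h1 | ⟨k, h1⟩ := hookWt_eq_zero_or_pow s (z'' :: l)
          · exact .inl ⟨by simp [h1], by simp [h1]⟩
          · right
            split_ifs
            · exact ⟨0, k + 1, by rw [h1, zero_add, pow_succ'], by rw [h1, pow_succ']⟩
            · exact ⟨1, k, by rw [h1, pow_add, pow_one], by rw [h1, one_mul]⟩
    · simp only [hookWt, hz, if_false]
      obtain h1 | ⟨k, h1⟩ := hookWt_eq_zero_or_pow s (z' :: l)
      · exact .inl ⟨by simp [h1], h1⟩
      · right
        split_ifs
        · exact ⟨1, k, by rw [h1, pow_add, pow_one], h1⟩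
        · exact ⟨0, k, by rw [h1, one_mul, zero_add], h1⟩

noncomputable def content {n : ℕ} (v : Fin n → ℕ) : ℕ →₀ ℕ := ∑ y, Finsupp.single (v y) 1

theorem content_apply {n : ℕ} (v : Fin n → ℕ) (i : ℕ) :
    content v i = (Finset.univ.filter fun y => v y = i).card := by
  rw [content, Finsupp.finsetSum_apply, Finset.card_filter]
  simp only [Finsupp.single_apply]

theorem degree_content {n : ℕ} (v : Fin n → ℕ) : (content v).degree = n := by
  simp [content, map_sum]

theorem content_insertNth {n : ℕ} (x : Fin (n + 1)) (i : ℕ) (v : Fin n → ℕ) :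
    content (x.insertNth i v : Fin (n + 1) → ℕ) = content v + Finsupp.single i 1 := by
  simp [content, Fin.sum_univ_succAbove _ x, add_comm]

theorem content_cons {n : ℕ} (i : ℕ) (v : Fin n → ℕ) :
    content (Fin.cons i v : Fin (n + 1) → ℕ) = content v + Finsupp.single i 1 := by
  simp [content, Fin.sum_univ_succ, add_comm]

theorem content_comp_equiv {n : ℕ} (v : Fin n → ℕ) (π : Equiv.Perm (Fin n)) :
    content (v ∘ π) = content v :=
  Equiv.sum_comp π fun y => Finsupp.single (v y) 1

theorem mem_support_content {n : ℕ} (v : Fin n → ℕ) (y : Fin n) : v y ∈ (content v).support := by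
  rw [Finsupp.mem_support_iff, content_apply]
  exact (Finset.card_pos.2 ⟨y, by simp⟩).ne'

/-- The words of length `n` and content `c`. -/
noncomputable def words (n : ℕ) (c : ℕ →₀ ℕ) : Finset (Fin n → ℕ) := by
  classical exact (Fintype.piFinset fun _ => c.support).filter fun v => content v = c

theorem mem_words {n : ℕ} {c : ℕ →₀ ℕ} {v : Fin n → ℕ} : v ∈ words n c ↔ content v = c := by
  classical
  rw [words, Finset.mem_filter, Fintype.mem_piFinset]
  refine ⟨fun h => h.2, fun h => ⟨fun y => h ▸ mem_support_content v y, h⟩⟩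

section WordSeries

variable {R : Type*} [CommRing R]

/-- The generating series, by content, of words over `{0, …, m - 1}` with respect to a
statistic. -/
noncomputable def wordSeries (m : ℕ) (φ : ∀ n, (Fin n → ℕ) → R) : MvPowerSeries ℕ R := by
  classical exact fun c =>
    if c.support ⊆ Finset.range m then ∑ v ∈ words c.degree c, φ c.degree v else 0

theorem coeff_wordSeries {m n : ℕ} (φ : ∀ n, (Fin n → ℕ) → R) {c : ℕ →₀ ℕ}
    (hc : c.support ⊆ Finset.range m) (hn : c.degree = n) :
    MvPowerSeries.coeff c (wordSeries m φ) = ∑ v ∈ words n c, φ n v := by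
  subst hn
  exact if_pos hc

theorem coeff_wordSeries_of_not {m : ℕ} (φ : ∀ n, (Fin n → ℕ) → R) {c : ℕ →₀ ℕ}
    (hc : ¬ c.support ⊆ Finset.range m) : MvPowerSeries.coeff c (wordSeries m φ) = 0 :=
  if_neg hc

theorem wordSeries_congr {m : ℕ} {φ ψ : ∀ n, (Fin n → ℕ) → R}
    (h : ∀ n v, (∀ y, v y < m) → φ n v = ψ n v) : wordSeries m φ = wordSeries m ψ := by
  ext c
  by_cases hc : c.support ⊆ Finset.range m
  · rw [coeff_wordSeries φ hc rfl, coeff_wordSeries ψ hc rfl]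
    refine Finset.sum_congr rfl fun v hv => h _ v fun y => Finset.mem_range.1 (hc ?_)
    rw [← mem_words.1 hv]
    exact mem_support_content v y
  · rw [coeff_wordSeries_of_not φ hc, coeff_wordSeries_of_not ψ hc]

theorem wordSeries_add (m : ℕ) (φ ψ : ∀ n, (Fin n → ℕ) → R) :
    wordSeries m (fun n v => φ n v + ψ n v) = wordSeries m φ + wordSeries m ψ := by
  ext c
  rw [map_add]
  by_cases hc : c.support ⊆ Finset.range m
  · simp only [coeff_wordSeries _ hc rfl, Finset.sum_add_distrib]
  · simp only [coeff_wordSeries_of_not _ hc, add_zero]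

theorem wordSeries_C_mul (m : ℕ) (a : R) (φ : ∀ n, (Fin n → ℕ) → R) :
    wordSeries m (fun n v => a * φ n v) = MvPowerSeries.C a * wordSeries m φ := by
  ext c
  rw [MvPowerSeries.coeff_C_mul]
  by_cases hc : c.support ⊆ Finset.range m
  · simp only [coeff_wordSeries _ hc rfl, Finset.mul_sum]
  · simp only [coeff_wordSeries_of_not _ hc, mul_zero]

theorem wordSeries_zero (m : ℕ) : wordSeries m (fun _ _ => (0 : R)) = 0 := by
  ext c
  by_cases hc : c.support ⊆ Finset.range m
  · simp [coeff_wordSeries _ hc rfl]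
  · simp [coeff_wordSeries_of_not _ hc]

theorem wordSeries_sum {ι : Type*} (m : ℕ) (t : Finset ι) (φ : ι → ∀ n, (Fin n → ℕ) → R) :
    wordSeries m (fun n v => ∑ i ∈ t, φ i n v) = ∑ i ∈ t, wordSeries m (φ i) := by
  classical
  induction t using Finset.induction_on with
  | empty => simpa using wordSeries_zero m
  | insert i t hi ih => simp only [Finset.sum_insert hi, wordSeries_add, ih]

theorem coeff_X_mul_of_eq_zero (i : ℕ) (B : MvPowerSeries ℕ R) {c : ℕ →₀ ℕ} (hc : c i = 0) :
    MvPowerSeries.coeff c (MvPowerSeries.X i * B) = 0 := by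
  classical
  rw [MvPowerSeries.X, MvPowerSeries.coeff_monomial_mul, if_neg]
  intro h
  have := h i
  simp [hc] at this

theorem coeff_X_mul_add_single (i : ℕ) (B : MvPowerSeries ℕ R) (c : ℕ →₀ ℕ) :
    MvPowerSeries.coeff (c + Finsupp.single i 1) (MvPowerSeries.X i * B) =
      MvPowerSeries.coeff c B := by
  rw [MvPowerSeries.X, add_comm, MvPowerSeries.coeff_add_monomial_mul, one_mul]

theorem eq_X_mul_of_coeff {i : ℕ} {A B : MvPowerSeries ℕ R}
    (h0 : ∀ c : ℕ →₀ ℕ, c i = 0 → MvPowerSeries.coeff c A = 0)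
    (h1 : ∀ c : ℕ →₀ ℕ, MvPowerSeries.coeff (c + Finsupp.single i 1) A =
      MvPowerSeries.coeff c B) : A = MvPowerSeries.X i * B := by
  ext c
  by_cases hc : c i = 0
  · rw [h0 c hc, coeff_X_mul_of_eq_zero i B hc]
  · obtain ⟨d, rfl⟩ : ∃ d, c = d + Finsupp.single i 1 :=
      ⟨c - Finsupp.single i 1, (tsub_add_cancel_of_le (by
        simpa [Finsupp.single_le_iff] using Nat.one_le_iff_ne_zero.2 hc)).symm⟩
    rw [h1, coeff_X_mul_add_single]

theorem support_add_single_subset {m i : ℕ} (hi : i < m) (c : ℕ →₀ ℕ) :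
    (c + Finsupp.single i 1).support ⊆ Finset.range m ↔ c.support ⊆ Finset.range m := by
  constructor
  · intro h j hj
    exact h (by simp at hj ⊢; omega)
  · intro h j hj
    by_cases hji : j = i
    · simpa [hji] using hi
    · refine h ?_
      simpa [Finsupp.single_apply, Ne.symm hji] using hj

theorem wordSeries_eq_X_mul {m i : ℕ} (hi : i < m) {φ ψ : ∀ n, (Fin n → ℕ) → R}
    (h0 : ∀ n v, (∀ y, v y ≠ i) → φ n v = 0)
    (h1 : ∀ n c, c.support ⊆ Finset.range m → c.degree = n →
      ∑ v ∈ words (n + 1) (c + Finsupp.single i 1), φ (n + 1) v = ∑ v ∈ words n c, ψ n v) :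
    wordSeries m φ = MvPowerSeries.X i * wordSeries m ψ := by
  refine eq_X_mul_of_coeff (fun c hc => ?_) fun c => ?_
  · by_cases hs : c.support ⊆ Finset.range m
    · rw [coeff_wordSeries _ hs rfl]
      refine Finset.sum_eq_zero fun v hv => h0 _ _ fun y hy => ?_
      have := mem_support_content v y
      rw [mem_words.1 hv, hy, Finsupp.mem_support_iff] at this
      exact this hc
    · exact coeff_wordSeries_of_not _ hs
  · by_cases hs : c.support ⊆ Finset.range m
    · rw [coeff_wordSeries _ hs rfl, coeff_wordSeries (n := c.degree + 1) _
        ((support_add_single_subset hi c).2 hs) (by simp), h1 _ c hs rfl]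
    · rw [coeff_wordSeries_of_not _ hs, coeff_wordSeries_of_not _
        (mt (support_add_single_subset hi c).1 hs)]

/-- The statistic vanishing on words that do not start with `z` and evaluating `φ` on the rest of
the other words. -/
def consStat (z : ℕ) (φ : List ℕ → R) : List ℕ → R
  | [] => 0
  | z' :: l => if z' = z then φ l else 0

theorem wordSeries_consStat {m z : ℕ} (hz : z < m) (φ : List ℕ → R) :
    wordSeries m (fun _ v => consStat z φ (List.ofFn v)) =
      MvPowerSeries.X z * wordSeries m (fun _ v => φ (List.ofFn v)) := by
  refine wordSeries_eq_X_mul hz (fun n v hv => ?_) fun n c _ _ => ?_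
  · cases n with
    | zero => simp [consStat]
    | succ n => simp [List.ofFn_succ, consStat, hv 0]
  · symm
    refine Finset.sum_of_injOn (fun v => (Fin.cons z v : Fin (n + 1) → ℕ)) ?_ ?_ ?_ ?_
    · intro v _ w _ h
      exact Fin.cons_right_injective (α := fun _ => ℕ) z h
    · intro v hv
      simp only [Finset.mem_coe, mem_words] at hv ⊢
      rw [content_cons, hv]
    · intro v hv hv'
      have : v 0 ≠ z := by
        rintro rfl
        refine hv' ⟨Fin.tail v, ?_, Fin.cons_self_tail v⟩
        rw [Finset.mem_coe, mem_words]
        rw [mem_words, ← Fin.cons_self_tail v, content_cons] at hv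
        simpa using hv
      simp [List.ofFn_succ, consStat, this]
    · intro v _
      simp [List.ofFn_succ, consStat]

end WordSeries

section Determinant

variable {R : Type*} [CommRing R]

/-- The geometric series `1 / (1 - a * X i)`. -/
noncomputable def geomSeries (a : R) (i : ℕ) : MvPowerSeries ℕ R := by
  classical exact fun c => if c.support ⊆ {i} then a ^ c i else 0

theorem coeff_geomSeries (a : R) (i : ℕ) {c : ℕ →₀ ℕ} (hc : c.support ⊆ {i}) :
    MvPowerSeries.coeff c (geomSeries a i) = a ^ c i :=
  if_pos hc

theorem coeff_geomSeries_of_not (a : R) (i : ℕ) {c : ℕ →₀ ℕ} (hc : ¬ c.support ⊆ {i}) :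
    MvPowerSeries.coeff c (geomSeries a i) = 0 :=
  if_neg hc

theorem geomSeries_mul (a : R) (i : ℕ) :
    geomSeries a i * (1 - MvPowerSeries.C a * MvPowerSeries.X i) = 1 := by
  classical
  suffices h : geomSeries a i - 1 = MvPowerSeries.X i * (MvPowerSeries.C a * geomSeries a i) by
    linear_combination h
  refine eq_X_mul_of_coeff (fun c hc => ?_) fun c => ?_
  · rw [map_sub, MvPowerSeries.coeff_one]
    by_cases hs : c.support ⊆ {i}
    · have : c = 0 := by
        ext j
        by_contra hj
        have := hs (Finsupp.mem_support_iff.2 hj)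
        rw [Finset.mem_singleton] at this
        exact hj (this ▸ hc)
      subst this
      rw [coeff_geomSeries a i hs]
      simp
    · have : c ≠ 0 := by
        rintro rfl
        simp at hs
      rw [coeff_geomSeries_of_not a i hs, if_neg this, sub_zero]
  · have h1 : c + Finsupp.single i 1 ≠ 0 := by
      intro h
      simpa using DFunLike.congr_fun h i
    have h2 : (c + Finsupp.single i 1).support ⊆ {i} ↔ c.support ⊆ {i} := by
      constructor
      · intro h j hj
        exact h (by simp at hj ⊢; omega)
      · intro h j hj
        by_contra hji
        have hji : j ≠ i := by simpa using hji
        exact hji (by simpa using h (by simpa [Finsupp.single_apply, Ne.symm hji] using hj))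
    rw [map_sub, MvPowerSeries.coeff_one, if_neg h1, sub_zero, MvPowerSeries.coeff_C_mul]
    by_cases hs : c.support ⊆ {i}
    · rw [coeff_geomSeries a i hs, coeff_geomSeries a i (h2.2 hs)]
      simp [pow_succ']
    · rw [coeff_geomSeries_of_not a i hs, coeff_geomSeries_of_not a i (mt h2.1 hs), mul_zero]

theorem geomSeries_one_mul (i : ℕ) :
    geomSeries (1 : R) i * (1 - MvPowerSeries.X i) = 1 := by
  simpa using geomSeries_mul (1 : R) i

noncomputable def geomProd (s : R) (m : ℕ) : MvPowerSeries ℕ R :=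
  ∏ i ∈ Finset.range m, geomSeries s i

theorem geomProd_succ_mul (s : R) (m : ℕ) :
    geomProd s (m + 1) * (1 - MvPowerSeries.C s * MvPowerSeries.X m) = geomProd s m := by
  rw [geomProd, Finset.prod_range_succ, mul_assoc, geomSeries_mul, mul_one, geomProd]

/-- The inverse of the generating series of words weighted by hooks. -/
noncomputable def hookDet (s : R) : ℕ → MvPowerSeries ℕ R
  | 0 => 1
  | m + 1 => geomSeries 1 m * (hookDet s m - MvPowerSeries.X m * geomProd s m)

theorem hookDet_succ_mul (s : R) (m : ℕ) :
    hookDet s (m + 1) * (1 - MvPowerSeries.X m) =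
      hookDet s m - MvPowerSeries.X m * geomProd s m := by
  rw [hookDet]
  linear_combination
    (hookDet s m - MvPowerSeries.X m * geomProd s m) * geomSeries_one_mul (R := R) m

/-- Series that only involve the variables of index less than `m`. -/
noncomputable def lowSeries (R : Type*) [CommRing R] (m : ℕ) : Subring (MvPowerSeries ℕ R) where
  carrier := {A | ∀ c : ℕ →₀ ℕ, ¬ c.support ⊆ Finset.range m → MvPowerSeries.coeff c A = 0}
  zero_mem' := by simp
  one_mem' := by
    classical
    intro c hc
    rw [MvPowerSeries.coeff_one, if_neg]
    rintro rfl
    simp at hc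
  add_mem' := fun ha hb c hc => by rw [map_add, ha c hc, hb c hc, add_zero]
  neg_mem' := fun ha c hc => by rw [map_neg, ha c hc, neg_zero]
  mul_mem' := fun {A B} ha hb c hc => by
    classical
    rw [MvPowerSeries.coeff_mul]
    refine Finset.sum_eq_zero fun p hp => ?_
    rw [Finset.HasAntidiagonal.mem_antidiagonal] at hp
    by_cases h1 : p.1.support ⊆ Finset.range m
    · by_cases h2 : p.2.support ⊆ Finset.range m
      · exact absurd (hp ▸ Finsupp.support_add.trans (Finset.union_subset h1 h2)) hc
      · rw [hb _ h2, mul_zero]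
    · rw [ha _ h1, zero_mul]

theorem lowSeries_mono {m k : ℕ} (h : m ≤ k) : lowSeries R m ≤ lowSeries R k :=
  fun _ hA c hc => hA c fun h' => hc (h'.trans (Finset.range_subset_range.2 h))

theorem geomSeries_mem (a : R) {i m : ℕ} (hi : i < m) : geomSeries a i ∈ lowSeries R m :=
  fun _ hc => coeff_geomSeries_of_not a i fun h =>
    hc (h.trans (by simpa using hi))

theorem X_mem_lowSeries {i m : ℕ} (hi : i < m) :
    (MvPowerSeries.X i : MvPowerSeries ℕ R) ∈ lowSeries R m := by
  classical
  intro c hc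
  rw [MvPowerSeries.coeff_X, if_neg]
  rintro rfl
  exact hc (Finsupp.support_single_subset.trans (by simpa using hi))

theorem geomProd_mem (s : R) (m : ℕ) : geomProd s m ∈ lowSeries R m :=
  Subring.prod_mem _ fun _ hi => geomSeries_mem s (Finset.mem_range.1 hi)

theorem hookDet_mem (s : R) : ∀ m, hookDet s m ∈ lowSeries R m
  | 0 => Subring.one_mem _
  | m + 1 => by
    have h := lowSeries_mono (R := R) m.le_succ
    exact Subring.mul_mem _ (geomSeries_mem 1 m.lt_succ_self) (Subring.sub_mem _
      (h (hookDet_mem s m)) (Subring.mul_mem _ (X_mem_lowSeries m.lt_succ_self)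
        (h (geomProd_mem s m))))

end Determinant

section HookSeries

variable {R : Type*} [CommRing R]

noncomputable def hookSeries (s : R) (m : ℕ) : MvPowerSeries ℕ R :=
  wordSeries m fun _ v => hookWt s (List.ofFn v)

/-- The hook weight restricted to words with first letter less than `z` and first hook top `x`. -/
def headTopWt (s : R) (x z : ℕ) : List ℕ → R
  | [] => 0
  | a :: l => if a < z ∧ hookTop (a :: l) = x then hookWt s (a :: l) else 0

noncomputable def headTopSeries (s : R) (m x z : ℕ) : MvPowerSeries ℕ R :=
  wordSeries m fun _ v => headTopWt s x z (List.ofFn v)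

theorem headTopSeries_zero (s : R) (m x : ℕ) : headTopSeries s m x 0 = 0 := by
  rw [← wordSeries_zero m, headTopSeries]
  refine wordSeries_congr fun n v _ => ?_
  cases List.ofFn v <;> simp [headTopWt]

theorem headTopWt_succ (s : R) (x z : ℕ) (l : List ℕ) :
    headTopWt s x (z + 1) l = headTopWt s x z l +
      consStat z (fun l => headTopWt s x (z + 1) (z :: l)) l := by
  cases l with
  | nil => simp [headTopWt, consStat]
  | cons a l =>
    simp only [headTopWt, consStat]
    rcases lt_trichotomy a z with h | rfl | h
    · simp [h, h.ne, h.trans z.lt_succ_self]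
    · simp
    · simp [h.ne', not_lt.2 h.le, not_le.2 h]

theorem headTopWt_cons_of_lt (s : R) {x z : ℕ} (h : z < x) (l : List ℕ) :
    headTopWt s x (z + 1) (z :: l) =
      s * (headTopWt s x (z + 1) l + consStat x (hookWt s) l) := by
  cases l with
  | nil => simp [headTopWt, consStat, hookWt]
  | cons a l =>
    by_cases ha : z < a
    · by_cases hx : a = x
      · simp [headTopWt, consStat, hookWt, hookTop, hx, h, not_lt.2 (Nat.succ_le_of_lt h)]
      · simp [headTopWt, consStat, hookTop, ha, hx, not_lt.2 (Nat.succ_le_of_lt ha)]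
    · have hx : a ≠ x := by omega
      have ha' : a < z + 1 := by omega
      by_cases ht : hookTop (a :: l) = x
      · simp [headTopWt, consStat, hookWt, hookTop, ha, hx, ha', ht, h]
      · simp [headTopWt, consStat, hookTop, ha, hx, ht]

theorem headTopWt_cons_of_le (s : R) {x z : ℕ} (h : x ≤ z) (l : List ℕ) :
    headTopWt s x (z + 1) (z :: l) = headTopWt s x (z + 1) l := by
  cases l with
  | nil => simp [headTopWt, hookWt]
  | cons a l =>
    by_cases ha : z < a
    · have hx : a ≠ x := by omega
      simp [headTopWt, hookTop, ha, hx, not_lt.2 (Nat.succ_le_of_lt ha)]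
    · have ha' : a < z + 1 := by omega
      by_cases ht : hookTop (a :: l) = x
      · simp [headTopWt, hookWt, hookTop, ha, ha', ht, not_lt.2 h]
      · simp [headTopWt, hookTop, ha, ht]

theorem headTopSeries_succ (s : R) {m z : ℕ} (hz : z < m) (x : ℕ) :
    headTopSeries s m x (z + 1) = headTopSeries s m x z + MvPowerSeries.X z *
      wordSeries m fun _ v => headTopWt s x (z + 1) (z :: List.ofFn v) := by
  rw [← wordSeries_consStat hz (fun l => headTopWt s x (z + 1) (z :: l)), headTopSeries,
    headTopSeries, ← wordSeries_add]
  exact wordSeries_congr fun n v _ => headTopWt_succ s x z _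

theorem headTopSeries_succ_of_lt (s : R) {m x z : ℕ} (hx : x < m) (h : z < x) :
    (1 - MvPowerSeries.C s * MvPowerSeries.X z) *
      (headTopSeries s m x (z + 1) + MvPowerSeries.X x * hookSeries s m) =
      headTopSeries s m x z + MvPowerSeries.X x * hookSeries s m := by
  have h1 := headTopSeries_succ s (h.trans hx) x
  simp only [headTopWt_cons_of_lt s h, wordSeries_C_mul, wordSeries_add,
    wordSeries_consStat hx] at h1
  rw [headTopSeries, hookSeries] at *
  linear_combination h1

theorem headTopSeries_succ_of_le (s : R) {m x z : ℕ} (hz : z < m) (h : x ≤ z) :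
    (1 - MvPowerSeries.X z) * headTopSeries s m x (z + 1) = headTopSeries s m x z := by
  have h1 := headTopSeries_succ s hz x
  simp only [headTopWt_cons_of_le s h] at h1
  rw [headTopSeries] at *
  linear_combination h1

theorem headTopSeries_of_le (s : R) {m x : ℕ} (hx : x < m) {z : ℕ} (h : z ≤ x) :
    headTopSeries s m x z = MvPowerSeries.X x * hookSeries s m * (geomProd s z - 1) := by
  induction z with
  | zero => simp [headTopSeries_zero, geomProd]
  | succ z ih =>
    have h1 := headTopSeries_succ_of_lt s hx h
    rw [ih (by omega)] at h1
    have h2 := geomSeries_mul s z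
    have h3 := geomProd_succ_mul s z
    linear_combination geomSeries s z * h1 - MvPowerSeries.X x * hookSeries s m *
      geomSeries s z * h3 - (headTopSeries s m x (z + 1) - MvPowerSeries.X x * hookSeries s m *
      (geomProd s (z + 1) - 1)) * h2

theorem sum_headTopSeries (s : R) {m z : ℕ} (hz : z ≤ m) :
    ∑ x ∈ Finset.range z, headTopSeries s m x z = (1 - hookDet s z) * hookSeries s m := by
  induction z with
  | zero => simp [hookDet]
  | succ z ih =>
    have h1 : (1 - MvPowerSeries.X z) * ∑ x ∈ Finset.range (z + 1), headTopSeries s m x (z + 1) =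
        ∑ x ∈ Finset.range (z + 1), headTopSeries s m x z := by
      rw [Finset.mul_sum]
      exact Finset.sum_congr rfl fun x hx =>
        headTopSeries_succ_of_le s hz (Nat.lt_succ_iff.1 (Finset.mem_range.1 hx))
    rw [Finset.sum_range_succ (fun x => headTopSeries s m x z), ih (by omega),
      headTopSeries_of_le s hz le_rfl] at h1
    have h2 := geomSeries_one_mul (R := R) z
    have h3 := hookDet_succ_mul s z
    set S := ∑ x ∈ Finset.range (z + 1), headTopSeries s m x (z + 1)
    linear_combination geomSeries 1 z * h1 - (S - (1 - hookDet s (z + 1)) * hookSeries s m) * h2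
      + geomSeries 1 z * hookSeries s m * h3

theorem hookTop_mem {l : List ℕ} (hl : l ≠ []) : hookTop l ∈ l := by
  obtain ⟨a, ha, h, -⟩ := hookTop_map id id l hl (List.pairwise_of_forall fun _ _ => Iff.rfl)
  rw [List.map_id] at h
  exact h ▸ ha

theorem hookWt_eq_sum (s : R) {m : ℕ} {l : List ℕ} (hl : ∀ a ∈ l, a < m) :
    hookWt s l = (if l = [] then 1 else 0) + ∑ x ∈ Finset.range m, headTopWt s x m l := by
  cases l with
  | nil => simp [hookWt, headTopWt]
  | cons a l =>
    have h1 : hookTop (a :: l) < m := hl _ (hookTop_mem (by simp))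
    simp [headTopWt, hl a (by simp), h1]

theorem wordSeries_nil (m : ℕ) :
    wordSeries m (fun _ v => if List.ofFn v = [] then (1 : R) else 0) = 1 := by
  classical
  ext c
  rw [MvPowerSeries.coeff_one]
  split_ifs with hc
  · subst hc
    rw [coeff_wordSeries (n := 0) _ (by simp) (by simp)]
    have : words 0 0 = {![]} := by
      ext v
      simp [mem_words, content, Subsingleton.elim v ![]]
    simp [this]
  · by_cases hs : c.support ⊆ Finset.range m
    · rw [coeff_wordSeries _ hs rfl]
      refine Finset.sum_eq_zero fun v _ => if_neg fun h => hc ?_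
      rw [List.ofFn_eq_nil_iff] at h
      exact (Finsupp.degree_eq_zero_iff c).1 h
    · exact coeff_wordSeries_of_not _ hs

theorem hookSeries_mul_hookDet (s : R) (m : ℕ) : hookSeries s m * hookDet s m = 1 := by
  have h1 : hookSeries s m = 1 + ∑ x ∈ Finset.range m, headTopSeries s m x m := by
    simp only [headTopSeries]
    rw [← wordSeries_nil m, ← wordSeries_sum, ← wordSeries_add, hookSeries]
    refine wordSeries_congr fun n v hv => hookWt_eq_sum s fun a ha => ?_
    obtain ⟨y, rfl⟩ := (List.mem_ofFn' _ _).1 ha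
    exact hv y
  rw [sum_headTopSeries s le_rfl] at h1
  linear_combination h1

end HookSeries

section Standardization

/-- The strict order on positions of a word given by letters, ties broken by position. -/
abbrev stdLT {n : ℕ} (v : Fin n → ℕ) (a b : Fin n) : Prop := v a < v b ∨ (v a = v b ∧ a < b)

/-- The standardization of a word. -/
def std {n : ℕ} (v : Fin n → ℕ) (y : Fin n) : ℕ :=
  (Finset.univ.filter fun a => stdLT v a y).card

/-- The number of letters of a word smaller than `i`. -/
def below {n : ℕ} (v : Fin n → ℕ) (i : ℕ) : ℕ :=
  (Finset.univ.filter fun a => v a < i).card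

theorem std_lt_std_of_stdLT {n : ℕ} {v : Fin n → ℕ} {a b : Fin n} (h : stdLT v a b) :
    std v a < std v b := by
  refine Finset.card_lt_card (Finset.ssubset_iff_of_subset ?_ |>.2 ⟨a, ?_, ?_⟩)
  · intro y hy
    simp only [Finset.mem_filter, Finset.mem_univ, true_and, stdLT] at hy h ⊢
    omega
  · simpa using h
  · simp [stdLT]

theorem std_lt_std {n : ℕ} {v : Fin n → ℕ} {a b : Fin n} :
    std v a < std v b ↔ stdLT v a b := by
  refine ⟨fun h => ?_, std_lt_std_of_stdLT⟩
  by_contra h'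
  have h1 : stdLT v b a ∨ a = b := by
    simp only [stdLT] at h' ⊢
    omega
  obtain h1 | rfl := h1
  · exact absurd (std_lt_std_of_stdLT h1) (by omega)
  · omega

theorem std_injective {n : ℕ} (v : Fin n → ℕ) : Function.Injective (std v) := by
  intro a b h
  by_contra hab
  have h1 : stdLT v a b ∨ stdLT v b a := by
    simp only [stdLT]
    omega
  obtain h1 | h1 := h1 <;> exact absurd (std_lt_std_of_stdLT h1) (by omega)

theorem std_lt {n : ℕ} (v : Fin n → ℕ) (y : Fin n) : std v y < n := by
  have := Finset.card_lt_univ_of_notMem (s := Finset.univ.filter fun a => stdLT v a y) (x := y)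
    (by simp [stdLT])
  simpa [std] using this

theorem exists_std_eq {n : ℕ} (v : Fin n → ℕ) {x : ℕ} (hx : x < n) : ∃ y, std v y = x := by
  have h : Function.Injective fun y => (⟨std v y, std_lt v y⟩ : Fin n) := fun a b hab =>
    std_injective v (by simpa using hab)
  obtain ⟨y, hy⟩ := (Finite.injective_iff_surjective.1 h) ⟨x, hx⟩
  exact ⟨y, by simpa using hy⟩

theorem below_le_std {n : ℕ} {v : Fin n → ℕ} {y : Fin n} {i : ℕ} (h : i ≤ v y) :
    below v i ≤ std v y :=
  Finset.card_le_card fun a ha => by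
    simp only [Finset.mem_filter, Finset.mem_univ, true_and, stdLT] at ha ⊢
    omega

theorem std_lt_below {n : ℕ} {v : Fin n → ℕ} {y : Fin n} {i : ℕ} (h : v y < i) :
    std v y < below v i := by
  refine Finset.card_lt_card (Finset.ssubset_iff_of_subset ?_ |>.2 ⟨y, ?_, ?_⟩)
  · intro a ha
    simp only [Finset.mem_filter, Finset.mem_univ, true_and, stdLT] at ha ⊢
    omega
  · simpa using h
  · simp [stdLT]

theorem below_le {n : ℕ} (v : Fin n → ℕ) (i : ℕ) : below v i ≤ n := by
  simpa [below] using Finset.card_le_univ (Finset.univ.filter fun a => v a < i)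

theorem below_mono {n : ℕ} (v : Fin n → ℕ) {i j : ℕ} (h : i ≤ j) : below v i ≤ below v j :=
  Finset.card_le_card fun a ha => by
    simp only [Finset.mem_filter, Finset.mem_univ, true_and] at ha ⊢
    omega

theorem letter_of_std {n : ℕ} {v : Fin n → ℕ} {y : Fin n} {i : ℕ} (h1 : below v i ≤ std v y)
    (h2 : std v y < below v (i + 1)) : v y = i := by
  by_contra h
  rcases lt_or_gt_of_ne h with h | h
  · exact absurd (std_lt_below h) (by omega)
  · exact absurd (below_le_std (i := i + 1) h) (by omega)

theorem coe_succAbove {n : ℕ} (x : Fin (n + 1)) (y : Fin n) :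
    (x.succAbove y : ℕ) = if (y : ℕ) < x then (y : ℕ) else y + 1 := by
  simp only [Fin.succAbove, Fin.lt_def, Fin.val_castSucc]
  split_ifs <;> simp

theorem below_insertNth {n : ℕ} (x : Fin (n + 1)) {m i : ℕ} (hi : i ≤ m) (w : Fin n → ℕ) :
    below (x.insertNth m w : Fin (n + 1) → ℕ) i = below w i := by
  simp only [below, Finset.card_filter, Fin.sum_univ_succAbove _ x, Fin.insertNth_apply_same,
    Fin.insertNth_apply_succAbove, not_lt.2 hi, if_false, zero_add]

theorem std_insertNth {n : ℕ} (x : Fin (n + 1)) {m : ℕ} (w : Fin n → ℕ) {y : Fin n}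
    (hy : w y < m) :
    std (x.insertNth m w : Fin (n + 1) → ℕ) (x.succAbove y) = std w y := by
  simp only [std, stdLT, Finset.card_filter, Fin.sum_univ_succAbove _ x, Fin.insertNth_apply_same,
    Fin.insertNth_apply_succAbove, not_lt.2 hy.le, hy.ne', false_and, or_false, if_false,
    zero_add, (Fin.strictMono_succAbove x).lt_iff_lt]

theorem std_update_self {n : ℕ} {v : Fin n → ℕ} {y : Fin n} {i m : ℕ} (hy : v y = m)
    (hi : i < m) :
    std (Function.update v y i) y =
      below v i + (Finset.univ.filter fun a => v a = i ∧ a < y).card := by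
  classical
  rw [std, below, ← Finset.card_union_of_disjoint]
  · congr 1
    ext a
    by_cases ha : a = y
    · subst ha
      simp [stdLT]
      omega
    · simp [stdLT, ha]
  · rw [Finset.disjoint_filter]
    omega

theorem std_eq_below_add {n : ℕ} {v : Fin n → ℕ} {y : Fin n} {i : ℕ} (hy : v y = i) :
    std v y = below v i + (Finset.univ.filter fun a => v a = i ∧ a < y).card := by
  classical
  rw [std, below, ← Finset.card_union_of_disjoint]
  · congr 1
    ext a
    simp [stdLT, hy]
  · rw [Finset.disjoint_filter]
    omega

theorem below_succ {n : ℕ} (v : Fin n → ℕ) (i : ℕ) :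
    below v (i + 1) = below v i + (Finset.univ.filter fun a => v a = i).card := by
  classical
  rw [below, below, ← Finset.card_union_of_disjoint]
  · congr 1
    ext a
    simp
    omega
  · rw [Finset.disjoint_filter]
    omega

theorem std_update_of_ne {n : ℕ} {v : Fin n → ℕ} {y a : Fin n} {i m : ℕ} (hy : v y = m)
    (ha : v a < m) :
    std (Function.update v y i) a =
      if std v a < std (Function.update v y i) y then std v a else std v a + 1 := by
  classical
  have hay : a ≠ y := by
    rintro rfl
    omega
  have h1 : std (Function.update v y i) a =
      std v a + if stdLT (Function.update v y i) y a then 1 else 0 := by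
    have : ∀ b, (if stdLT (Function.update v y i) b a then 1 else 0) =
        (if stdLT v b a then 1 else 0) +
          if b = y then (if stdLT (Function.update v y i) y a then 1 else 0) else 0 := by
      intro b
      by_cases hb : b = y
      · subst hb
        have : ¬ stdLT v b a := by
          simp only [stdLT]
          omega
        simp [this]
      · simp [stdLT, hb, hay]
    rw [std, std, Finset.card_filter, Finset.card_filter, Finset.sum_congr rfl fun b _ => this b,
      Finset.sum_add_distrib, Finset.sum_ite_eq' Finset.univ y, if_pos (Finset.mem_univ y)]
  simp only [← std_lt_std] at h1
  have h2 : std (Function.update v y i) a ≠ std (Function.update v y i) y :=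
    fun h => hay (std_injective _ h)
  split_ifs at h1 ⊢ <;> omega

end Standardization

section MarkedTokens

variable {R : Type*} [CommRing R]

/-- The weight of a position `a` sent to `b`: `Y` for a fixed point, `s` for an excedance. -/
def posWt (s Y : R) (a b : ℕ) : R := if b = a then Y else if a < b then s else 1

theorem posWt_skip (s Y : R) (q a b : ℕ) :
    posWt s Y (if a < q then a else a + 1) (if b < q then b else b + 1) = posWt s Y a b := by
  have h1 : (if b < q then b else b + 1) = (if a < q then a else a + 1) ↔ b = a := by
    split_ifs <;> omega
  have h2 : (if a < q then a else a + 1) < (if b < q then b else b + 1) ↔ a < b := by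
    split_ifs <;> omega
  simp only [posWt, h1, h2]

/-- The weight of the inverse standardization of a word, letters `≥ m` being ignored. -/
def tokWt (s Y : R) (m : ℕ) {n : ℕ} (v : Fin n → ℕ) : R :=
  ∏ y, if v y < m then posWt s Y (std v y) y else 1

theorem tokWt_insertNth (s Y : R) {m n : ℕ} (w : Fin n → ℕ) (x : Fin (n + 1)) :
    tokWt s Y m (x.insertNth m w : Fin (n + 1) → ℕ) =
      ∏ y, if w y < m then posWt s Y (std w y) (x.succAbove y) else 1 := by
  rw [tokWt, Fin.prod_univ_succAbove _ x, Fin.insertNth_apply_same, if_neg (lt_irrefl m), one_mul]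
  refine Finset.prod_congr rfl fun y _ => ?_
  rw [Fin.insertNth_apply_succAbove]
  split_ifs with h
  · rw [std_insertNth x w h]
  · rfl

theorem tokWt_insertNth_of_below_le (s Y : R) {m n : ℕ} (w : Fin n → ℕ) {x : Fin (n + 1)}
    (hx : below w m ≤ x) :
    tokWt s Y m (x.insertNth m w : Fin (n + 1) → ℕ) = tokWt s Y m w := by
  rw [tokWt_insertNth, tokWt]
  refine Finset.prod_congr rfl fun y _ => ?_
  split_ifs with h
  · have h1 := std_lt_below h
    have h2 : std w y = if std w y < x then std w y else std w y + 1 := by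
      rw [if_pos (by omega)]
    rw [coe_succAbove, h2, posWt_skip, ← h2]
  · rfl

/-- The position in `v` at which a letter `m` is inserted when popping, given that the letter at
`y` is lowered to `i`. -/
def popPos {n : ℕ} (v : Fin n → ℕ) (i : ℕ) (y : Fin n) : Fin (n + 1) :=
  ⟨std (Function.update v y i) y, (std_lt _ _).trans n.lt_succ_self⟩

def popWord {n : ℕ} (m : ℕ) (v : Fin n → ℕ) (i : ℕ) (y : Fin n) : Fin (n + 1) → ℕ :=
  (popPos v i y).insertNth m (Function.update v y i)

theorem tokWt_popWord (s Y : R) {m n i : ℕ} (hi : i < m) {v : Fin n → ℕ} {y : Fin n}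
    (hy : v y = m) :
    tokWt s Y m (popWord m v i y) =
      (if (popPos v i y : ℕ) ≤ y then s else 1) * tokWt s Y m v := by
  rw [popWord, tokWt_insertNth, tokWt, ← Finset.mul_prod_erase _ _ (Finset.mem_univ y),
    ← Finset.mul_prod_erase Finset.univ (fun y => if v y < m then _ else _) (Finset.mem_univ y)]
  simp only [Function.update_self, hi, hy, lt_irrefl, if_true, if_false, one_mul]
  congr 1
  · rw [coe_succAbove, posWt]
    change (if _ then Y else if std (Function.update v y i) y < _ then s else 1) = _
    have hx : (popPos v i y : ℕ) = std (Function.update v y i) y := rfl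
    rw [← hx]
    rcases lt_or_ge (y : ℕ) (popPos v i y) with h | h
    · rw [if_pos h, if_neg h.ne, if_neg h.not_gt, if_neg h.not_ge]
    · rw [if_neg h.not_gt, if_neg (by omega), if_pos (by omega), if_pos h]
  · refine Finset.prod_congr rfl fun a ha => ?_
    have hay := Finset.ne_of_mem_erase ha
    rw [Function.update_of_ne hay]
    split_ifs with h
    · rw [std_update_of_ne hy h, coe_succAbove]
      exact posWt_skip s Y _ _ _
    · rfl

theorem popPos_le_iff {m n i : ℕ} (hi : i < m) {v : Fin n → ℕ} {y : Fin n} (hy : v y = m) :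
    (popPos v i y : ℕ) ≤ y ↔
      below v (i + 1) ≤ y ∨ ∃ a, v a = i ∧ std v a = y ∧ y < a := by
  have hx : (popPos v i y : ℕ) = _ := std_update_self hy hi
  constructor
  · intro h
    by_contra! h'
    obtain ⟨a, ha⟩ := exists_std_eq v y.2
    have hai : v a = i := letter_of_std (by omega) (by omega)
    have h1 := h'.2 a hai ha
    have hne : a ≠ y := by
      rintro rfl
      omega
    have h2 := std_eq_below_add hai
    have h3 : (Finset.univ.filter fun b => v b = i ∧ b < a).card <
        (Finset.univ.filter fun b => v b = i ∧ b < y).card := by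
      refine Finset.card_lt_card (Finset.ssubset_iff_of_subset ?_ |>.2 ⟨a, ?_, by simp⟩)
      · intro b
        simp
        omega
      · simp
        omega
    omega
  · rintro (h | ⟨a, hai, ha, h⟩)
    · rw [below_succ] at h
      have h3 : (Finset.univ.filter fun b => v b = i ∧ b < y).card ≤
          (Finset.univ.filter fun b => v b = i).card :=
        Finset.card_le_card fun b => by simp; omega
      omega
    · have h2 := std_eq_below_add hai
      have h3 : (Finset.univ.filter fun b => v b = i ∧ b < y).card ≤
          (Finset.univ.filter fun b => v b = i ∧ b < a).card :=
        Finset.card_le_card fun b => by simp; omega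
      omega

theorem lt_popPos_iff {m n i : ℕ} (hi : i < m) {v : Fin n → ℕ} {y : Fin n} (hy : v y = m) :
    (y : ℕ) < popPos v i y ↔
      y < below v i ∨ ∃ a, v a = i ∧ std v a = y ∧ a < y := by
  rw [← not_le, popPos_le_iff hi hy]
  constructor
  · intro h
    by_contra! h'
    push Not at h
    obtain ⟨a, ha⟩ := exists_std_eq v y.2
    have hai : v a = i := letter_of_std (by omega) (by omega)
    have h1 := h'.2 a hai ha
    have h2 := h.2 a hai ha
    have : a = y := by omega
    subst this
    omega
  · rintro (h | ⟨a, hai, ha, h⟩) (h' | ⟨b, hbi, hb, h'⟩)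
    · have := below_mono v (Nat.le_add_right i 1)
      omega
    · have := below_le_std (v := v) (y := b) hbi.ge
      omega
    · have := std_lt_below (v := v) (y := a) (i := i + 1) (by omega)
      omega
    · have := std_injective v (ha.trans hb.symm)
      subst this
      omega

theorem content_update {n : ℕ} (v : Fin n → ℕ) (y : Fin n) (i m : ℕ) (hy : v y = m) :
    content (Function.update v y i) + Finsupp.single m 1 = content v + Finsupp.single i 1 := by
  rw [content, content, ← Finset.add_sum_erase _ _ (Finset.mem_univ y),
    ← Finset.add_sum_erase Finset.univ (fun a => Finsupp.single (v a) 1) (Finset.mem_univ y),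
    Function.update_self, hy, Finset.sum_congr rfl fun a ha => by
      rw [Function.update_of_ne (Finset.ne_of_mem_erase ha)]]
  abel

theorem content_popWord {n : ℕ} (v : Fin n → ℕ) (y : Fin n) (i m : ℕ) (hy : v y = m) :
    content (popWord m v i y) = content v + Finsupp.single i 1 := by
  rw [popWord, content_insertNth, content_update v y i m hy]

theorem popWord_apply {n : ℕ} (v : Fin n → ℕ) (y : Fin n) (i m : ℕ) :
    popWord m v i y (popPos v i y) = m := by
  rw [popWord, Fin.insertNth_apply_same]

theorem popWord_apply_succAbove {n : ℕ} (v : Fin n → ℕ) (y : Fin n) (i m : ℕ) :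
    popWord m v i y ((popPos v i y).succAbove y) = i := by
  rw [popWord, Fin.insertNth_apply_succAbove, Function.update_self]

theorem std_popWord_succAbove {n : ℕ} (v : Fin n → ℕ) (y : Fin n) {i m : ℕ} (hi : i < m) :
    std (popWord m v i y) ((popPos v i y).succAbove y) = popPos v i y := by
  rw [popWord, std_insertNth _ _ (by rwa [Function.update_self])]
  rfl

theorem sum_insertNth (m n : ℕ) (c : ℕ →₀ ℕ) (φ : (Fin (n + 1) → ℕ) → Fin (n + 1) → R) :
    ∑ v ∈ words (n + 1) (c + Finsupp.single m 1), ∑ x, (if v x = m then φ v x else 0) =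
      ∑ w ∈ words n c, ∑ x : Fin (n + 1), φ (x.insertNth m w) x := by
  rw [← Finset.sum_product', ← Finset.sum_product', ← Finset.sum_filter]
  symm
  refine Finset.sum_nbij (fun p => (p.2.insertNth m p.1, p.2)) ?_ ?_ ?_ fun _ _ => rfl
  · rintro ⟨w, x⟩ h
    simp only [Finset.mem_product, Finset.mem_univ, and_true, mem_words, Finset.mem_filter,
      Fin.insertNth_apply_same] at h ⊢
    rw [content_insertNth, h]
  · rintro ⟨w, x⟩ _ ⟨w', x'⟩ _ h
    simp only [Prod.mk.injEq] at h
    obtain ⟨h, rfl⟩ := h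
    rw [Fin.insertNth_right_injective (α := fun _ => ℕ) (p := x) m h]
  · rintro ⟨v, x⟩ h
    simp only [Finset.coe_filter, Finset.mem_product, Finset.mem_univ, and_true, mem_words,
      Set.mem_ofPred_eq] at h
    obtain ⟨h, rfl⟩ := h
    refine ⟨(x.removeNth v, x), ?_, ?_⟩
    · rw [← Fin.insertNth_self_removeNth x v, content_insertNth] at h
      simp only [Fin.insertNth_apply_same] at h
      simpa [mem_words] using h
    · simp

theorem sum_popWord {i m : ℕ} (hi : i < m) (n : ℕ) (c : ℕ →₀ ℕ)
    (φ : (Fin (n + 1) → ℕ) → Fin (n + 1) → R) :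
    ∑ v ∈ words (n + 1) (c + Finsupp.single i 1), ∑ x,
        (if v x = m ∧ ∃ y, v y = i ∧ std v y = x then φ v x else 0) =
      ∑ v ∈ words n c, ∑ y, (if v y = m then φ (popWord m v i y) (popPos v i y) else 0) := by
  rw [← Finset.sum_product', ← Finset.sum_product', ← Finset.sum_filter, ← Finset.sum_filter]
  symm
  refine Finset.sum_nbij (fun p => (popWord m p.1 i p.2, popPos p.1 i p.2)) ?_ ?_ ?_
    fun _ _ => rfl
  · rintro ⟨v, y⟩ h
    simp only [Finset.mem_product, Finset.mem_univ, and_true, mem_words, Finset.mem_filter] at h ⊢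
    exact ⟨by rw [content_popWord _ _ _ _ h.2, h.1], popWord_apply _ _ _ _, _,
      popWord_apply_succAbove _ _ _ _, std_popWord_succAbove _ _ hi⟩
  · rintro ⟨v, y⟩ h ⟨v', y'⟩ h' heq
    simp only [Prod.mk.injEq] at heq
    obtain ⟨heq, hx⟩ := heq
    simp only [Finset.coe_filter, Finset.mem_product, Finset.mem_univ, and_true, mem_words,
      Set.mem_ofPred_eq] at h h'
    have h1 := heq
    rw [popWord, popWord, hx] at h1
    have h2 := (Fin.insertNth_right_injective (α := fun _ => ℕ) _) h1
    have h3 : y = y' := by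
      have := congrArg Fin.val hx
      simp only [popPos] at this
      rw [h2] at this
      exact std_injective _ this
    subst h3
    have h4 : v = v' := by
      funext a
      by_cases ha : a = y
      · rw [ha, h.2, h'.2]
      · simpa [ha] using congrFun h2 a
    rw [h4]
  · rintro ⟨v, x⟩ h
    simp only [Finset.coe_filter, Finset.mem_product, Finset.mem_univ, and_true, mem_words,
      Set.mem_ofPred_eq] at h
    obtain ⟨h, hx, a, ha, hax⟩ := h
    have hne : a ≠ x := by
      rintro rfl
      omega
    obtain ⟨y, rfl⟩ := Fin.exists_succAbove_eq hne
    obtain ⟨w, rfl⟩ : ∃ w : Fin n → ℕ, v = x.insertNth m w :=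
      ⟨x.removeNth v, by rw [← hx]; simp⟩
    rw [Fin.insertNth_apply_succAbove] at ha
    rw [std_insertNth x w (by omega)] at hax
    have h1 : Function.update (Function.update w y m) y i = w := by
      rw [Function.update_idem, ← ha, Function.update_eq_self]
    have h2 : popPos (Function.update w y m) i y = x := by
      apply Fin.ext
      simp only [popPos, h1, hax]
    refine ⟨(Function.update w y m, y), ?_, ?_⟩
    · have h3 := content_update w y m i ha
      rw [content_insertNth] at h
      simpa [mem_words, h] using h3
    · simp only [popWord, h1, h2]

end MarkedTokens

section MarkedSeries

variable {R : Type*} [CommRing R]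

/-- The statistic summing the weight of a word over its marked letters `m` satisfying `P`. -/
noncomputable def markStat (s Y : R) (m : ℕ) (P : ∀ n, (Fin n → ℕ) → Fin n → Prop) (n : ℕ)
    (v : Fin n → ℕ) : R := by
  classical exact ∑ x, if v x = m ∧ P n v x then tokWt s Y m v else 0

noncomputable def markSeries (s Y : R) (m : ℕ) (P : ∀ n, (Fin n → ℕ) → Fin n → Prop) :
    MvPowerSeries ℕ R :=
  wordSeries (m + 1) (markStat s Y m P)

theorem markSeries_eq_add (s Y : R) {m : ℕ} {P Q S : ∀ n, (Fin n → ℕ) → Fin n → Prop}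
    (h : ∀ n (v : Fin n → ℕ) x, v x = m → (P n v x ↔ Q n v x ∨ S n v x))
    (h' : ∀ n (v : Fin n → ℕ) x, v x = m → Q n v x → ¬ S n v x) :
    markSeries s Y m P = markSeries s Y m Q + markSeries s Y m S := by
  classical
  rw [markSeries, markSeries, markSeries, ← wordSeries_add]
  refine wordSeries_congr fun n v _ => ?_
  rw [markStat, markStat, markStat, ← Finset.sum_add_distrib]
  refine Finset.sum_congr rfl fun x _ => ?_
  by_cases hx : v x = m
  · have h1 := h n v x hx
    have h2 := h' n v x hx
    by_cases hq : Q n v x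
    · simp [hx, h1, hq, h2 hq]
    · simp [hx, h1, hq]
  · simp [hx]

/-- Marked letters whose position is at least the number of letters smaller than `i`. -/
def IsHigh (i n : ℕ) (v : Fin n → ℕ) (x : Fin n) : Prop := below v i ≤ x

def IsLow (i n : ℕ) (v : Fin n → ℕ) (x : Fin n) : Prop := (x : ℕ) < below v i

/-- Marked letters whose position is the standardization of a letter `i` further right. -/
def IsExc (i n : ℕ) (v : Fin n → ℕ) (x : Fin n) : Prop := ∃ a, v a = i ∧ std v a = x ∧ x < a

def IsAntiExc (i n : ℕ) (v : Fin n → ℕ) (x : Fin n) : Prop :=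
  ∃ a, v a = i ∧ std v a = x ∧ a < x

theorem isExc_popWord_iff {m n i : ℕ} (hi : i < m) (v : Fin n → ℕ) (y : Fin n) :
    IsExc i (n + 1) (popWord m v i y) (popPos v i y) ↔ (popPos v i y : ℕ) ≤ y := by
  have h : ∀ a, std (popWord m v i y) a = popPos v i y → a = (popPos v i y).succAbove y :=
    fun a ha => std_injective _ (ha.trans (std_popWord_succAbove v y hi).symm)
  constructor
  · rintro ⟨a, -, ha, hlt⟩
    rw [h a ha, Fin.lt_def, coe_succAbove] at hlt
    split_ifs at hlt <;> omega
  · intro hle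
    refine ⟨_, popWord_apply_succAbove v y i m, std_popWord_succAbove v y hi, ?_⟩
    rw [Fin.lt_def, coe_succAbove]
    split_ifs <;> omega

theorem isAntiExc_popWord_iff {m n i : ℕ} (hi : i < m) (v : Fin n → ℕ) (y : Fin n) :
    IsAntiExc i (n + 1) (popWord m v i y) (popPos v i y) ↔ (y : ℕ) < popPos v i y := by
  have h : ∀ a, std (popWord m v i y) a = popPos v i y → a = (popPos v i y).succAbove y :=
    fun a ha => std_injective _ (ha.trans (std_popWord_succAbove v y hi).symm)
  constructor
  · rintro ⟨a, -, ha, hlt⟩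
    rw [h a ha, Fin.lt_def, coe_succAbove] at hlt
    split_ifs at hlt <;> omega
  · intro hle
    refine ⟨_, popWord_apply_succAbove v y i m, std_popWord_succAbove v y hi, ?_⟩
    rw [Fin.lt_def, coe_succAbove]
    split_ifs
    omega

theorem markSeries_pop (s Y : R) {m i : ℕ} (hi : i < m)
    {P Q : ∀ n, (Fin n → ℕ) → Fin n → Prop} (r : R)
    (hP : ∀ n (v : Fin n → ℕ) x, P n v x → ∃ a, v a = i ∧ std v a = x)
    (hPQ : ∀ n (v : Fin n → ℕ) y, v y = m →
      (P (n + 1) (popWord m v i y) (popPos v i y) ↔ Q n v y))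
    (hQ : ∀ n (v : Fin n → ℕ) y, v y = m → Q n v y →
      tokWt s Y m (popWord m v i y) = r * tokWt s Y m v) :
    markSeries s Y m P = MvPowerSeries.X i * (MvPowerSeries.C r * markSeries s Y m Q) := by
  classical
  rw [markSeries, markSeries, ← wordSeries_C_mul]
  refine wordSeries_eq_X_mul (by omega) (fun n v hv => ?_) fun n c _ _ => ?_
  · rw [markStat]
    refine Finset.sum_eq_zero fun x _ => if_neg fun h => ?_
    obtain ⟨a, ha, -⟩ := hP n v x h.2
    exact hv a ha
  · have h1 := sum_popWord hi n c fun v x => if P (n + 1) v x then tokWt s Y m v else (0 : R)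
    trans ∑ v ∈ words (n + 1) (c + Finsupp.single i 1), ∑ x,
        (if v x = m ∧ ∃ y, v y = i ∧ std v y = x then
          (if P (n + 1) v x then tokWt s Y m v else 0) else 0)
    · refine Finset.sum_congr rfl fun v _ => Finset.sum_congr rfl fun x _ => ?_
      by_cases h : P (n + 1) v x
      · simp [h, hP _ _ _ h]
      · simp [h]
    rw [h1]
    refine Finset.sum_congr rfl fun v _ => ?_
    rw [markStat, Finset.mul_sum]
    refine Finset.sum_congr rfl fun y _ => ?_
    by_cases hy : v y = m
    · by_cases h : Q n v y
      · simp [hy, hPQ n v y hy, h, hQ n v y hy h]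
      · simp [hPQ n v y hy, h]
    · simp [hy]

theorem markSeries_isExc (s Y : R) {m i : ℕ} (hi : i < m) :
    markSeries s Y m (IsExc i) = MvPowerSeries.X i * (MvPowerSeries.C s *
      (markSeries s Y m (IsHigh (i + 1)) + markSeries s Y m (IsExc i))) := by
  rw [← markSeries_eq_add (P := fun n v y => (popPos v i y : ℕ) ≤ y)
    (Q := IsHigh (i + 1)) (S := IsExc i) s Y
    (fun n v y hy => popPos_le_iff hi hy)]
  · refine markSeries_pop s Y hi s (fun n v x ⟨a, h1, h2, _⟩ => ⟨a, h1, h2⟩)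
      (fun n v y _ => isExc_popWord_iff hi v y) fun n v y hy h => ?_
    rw [tokWt_popWord s Y hi hy, if_pos h]
  · rintro n v x _ h ⟨a, ha, hax, -⟩
    have := std_lt_below (v := v) (y := a) (i := i + 1) (by omega)
    rw [IsHigh] at h
    omega

theorem markSeries_isAntiExc (s Y : R) {m i : ℕ} (hi : i < m) :
    markSeries s Y m (IsAntiExc i) = MvPowerSeries.X i *
      (markSeries s Y m (IsLow i) + markSeries s Y m (IsAntiExc i)) := by
  rw [← markSeries_eq_add (P := fun n v y => (y : ℕ) < popPos v i y)
    (Q := IsLow i) (S := IsAntiExc i) s Y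
    (fun n v y hy => lt_popPos_iff hi hy)]
  · have h1 := markSeries_pop s Y hi (P := IsAntiExc i)
      (Q := fun n v y => (y : ℕ) < popPos v i y) 1
      (fun n v x ⟨a, h1, h2, _⟩ => ⟨a, h1, h2⟩)
      (fun n v y _ => isAntiExc_popWord_iff hi v y) fun n v y hy h => by
        rw [tokWt_popWord s Y hi hy, if_neg h.not_ge]
    rwa [map_one, one_mul] at h1
  · rintro n v x _ h ⟨a, ha, hax, -⟩
    have := below_le_std (v := v) (y := a) ha.ge
    rw [IsLow] at h
    omega

theorem markSeries_isHigh_zero (s Y : R) (m i : ℕ) :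
    markSeries s Y m (IsHigh 0) =
      markSeries s Y m (IsHigh i) + markSeries s Y m (IsLow i) := by
  refine markSeries_eq_add s Y (fun n v x _ => ?_) fun n v x _ => ?_
  · simp only [IsHigh, IsLow, below]
    simp
    omega
  · simp only [IsHigh, IsLow]
    omega

theorem markSeries_isHigh (s Y : R) {m i : ℕ} (hi : i < m) :
    markSeries s Y m (IsHigh i) = markSeries s Y m (IsHigh (i + 1)) +
      (markSeries s Y m (IsExc i) + markSeries s Y m (IsAntiExc i)) := by
  rw [← markSeries_eq_add s Y (P := fun n v x => ∃ a, v a = i ∧ std v a = x) (Q := IsExc i)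
    (S := IsAntiExc i)]
  · refine markSeries_eq_add s Y (fun n v x _ => ?_) fun n v x _ => ?_
    · have h0 := below_mono v (Nat.le_add_right i 1)
      constructor
      · intro h
        by_cases h' : below v (i + 1) ≤ x
        · exact .inl h'
        · obtain ⟨a, ha⟩ := exists_std_eq v x.2
          rw [IsHigh] at h
          exact .inr ⟨a, letter_of_std (by omega) (by omega), ha⟩
      · rintro (h | ⟨a, ha, hax⟩)
        · exact h0.trans h
        · exact (below_le_std ha.ge).trans hax.le
    · rintro h ⟨a, ha, hax⟩
      have := std_lt_below (v := v) (y := a) (i := i + 1) (by omega)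
      rw [IsHigh] at h
      omega
  · intro n v x hx
    constructor
    · rintro ⟨a, ha, hax⟩
      have : a ≠ x := by
        rintro rfl
        omega
      rcases lt_or_gt_of_ne this with h | h
      · exact .inr ⟨a, ha, hax, h⟩
      · exact .inl ⟨a, ha, hax, h⟩
    · rintro (⟨a, ha, hax, -⟩ | ⟨a, ha, hax, -⟩) <;> exact ⟨a, ha, hax⟩
  · rintro n v x _ ⟨a, ha, hax, h⟩ ⟨b, hb, hbx, h'⟩
    have := std_injective v (hax.trans hbx.symm)
    omega

theorem markSeries_isHigh_mul (s Y : R) {m i : ℕ} (hi : i < m) :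
    (1 - MvPowerSeries.C s * MvPowerSeries.X i) * markSeries s Y m (IsHigh i) =
      (1 - MvPowerSeries.X i) * markSeries s Y m (IsHigh (i + 1)) +
        (1 - MvPowerSeries.C s * MvPowerSeries.X i) * MvPowerSeries.X i *
          markSeries s Y m (IsHigh 0) := by
  have h1 := markSeries_isExc s Y hi
  have h2 := markSeries_isAntiExc s Y hi
  have h3 := markSeries_isHigh s Y hi
  have h4 := markSeries_isHigh_zero s Y m i
  linear_combination (1 - MvPowerSeries.C s * MvPowerSeries.X i) * (1 - MvPowerSeries.X i) * h3 +
    (1 - MvPowerSeries.X i) * h1 + (1 - MvPowerSeries.C s * MvPowerSeries.X i) * h2 -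
    (1 - MvPowerSeries.C s * MvPowerSeries.X i) * MvPowerSeries.X i * h4

theorem hookDet_mul_markSeries (s Y : R) {m i : ℕ} (hi : i ≤ m) :
    hookDet s i * markSeries s Y m (IsHigh 0) = geomProd s i * markSeries s Y m (IsHigh i) := by
  induction i with
  | zero => simp [hookDet, geomProd]
  | succ i ih =>
    have h1 := ih (by omega)
    have h2 := markSeries_isHigh_mul s Y hi
    have h3 := geomProd_succ_mul s i
    have h4 := hookDet_succ_mul s i
    have h5 := geomSeries_one_mul (R := R) i
    set T := markSeries s Y m (IsHigh 0)
    have h6 : (1 - MvPowerSeries.X i) * (hookDet s (i + 1) * T -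
        geomProd s (i + 1) * markSeries s Y m (IsHigh (i + 1))) = 0 := by
      linear_combination T * h4 + h1 + geomProd s (i + 1) * h2 -
        (markSeries s Y m (IsHigh i) - MvPowerSeries.X i * T) * h3
    linear_combination geomSeries 1 i * h6 - (hookDet s (i + 1) * T -
        geomProd s (i + 1) * markSeries s Y m (IsHigh (i + 1))) * h5

end MarkedSeries

section PermSeries

variable {R : Type*} [CommRing R]

/-- The weight of the inverse standardization of a word. -/
def permWt (s Y : R) {n : ℕ} (v : Fin n → ℕ) : R := ∏ y, posWt s Y (std v y) y

noncomputable def tokSeries (s Y : R) (m : ℕ) : MvPowerSeries ℕ R :=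
  wordSeries (m + 1) fun _ v => tokWt s Y m v

noncomputable def permSeries (s Y : R) (m : ℕ) : MvPowerSeries ℕ R :=
  wordSeries m fun _ v => permWt s Y v

theorem tokWt_eq_permWt (s Y : R) {m n : ℕ} {v : Fin n → ℕ} (h : ∀ y, v y < m) :
    tokWt s Y m v = permWt s Y v :=
  Finset.prod_congr rfl fun y _ => if_pos (h y)

theorem coeff_markSeries_isHigh_zero (s Y : R) (m : ℕ) (c : ℕ →₀ ℕ) :
    MvPowerSeries.coeff c (markSeries s Y m (IsHigh 0)) =
      c m * MvPowerSeries.coeff c (tokSeries s Y m) := by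
  classical
  rw [markSeries, tokSeries]
  by_cases hc : c.support ⊆ Finset.range (m + 1)
  · rw [coeff_wordSeries _ hc rfl, coeff_wordSeries _ hc rfl, Finset.mul_sum]
    refine Finset.sum_congr rfl fun v hv => ?_
    have h0 : below v 0 = 0 := by simp [below]
    have h1 := content_apply v m
    rw [mem_words.1 hv] at h1
    rw [h1, markStat, Finset.card_filter, Nat.cast_sum, Finset.sum_mul]
    refine Finset.sum_congr rfl fun x _ => ?_
    by_cases hx : v x = m <;> simp [hx, IsHigh, h0]
  · rw [coeff_wordSeries_of_not _ hc, coeff_wordSeries_of_not _ hc, mul_zero]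

theorem below_of_forall_lt {n : ℕ} {v : Fin n → ℕ} {i : ℕ} (h : ∀ y, v y < i) :
    below v i = n := by
  simp [below, h]

theorem letter_lt_of_mem_words {n m : ℕ} {c : ℕ →₀ ℕ} (hc : c.support ⊆ Finset.range m)
    {v : Fin n → ℕ} (hv : v ∈ words n c) (y : Fin n) : v y < m :=
  Finset.mem_range.1 (hc (mem_words.1 hv ▸ mem_support_content v y))

theorem coeff_markSeries_isHigh (s Y : R) (m : ℕ) (c : ℕ →₀ ℕ) :
    MvPowerSeries.coeff c (markSeries s Y m (IsHigh m)) =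
      c m * MvPowerSeries.coeff c (MvPowerSeries.X m * tokSeries s Y m) := by
  classical
  rw [markSeries, tokSeries]
  by_cases hc : c.support ⊆ Finset.range (m + 1)
  · by_cases hm : c m = 0
    · rw [hm, Nat.cast_zero, zero_mul, coeff_wordSeries _ hc rfl]
      refine Finset.sum_eq_zero fun v hv => Finset.sum_eq_zero fun x _ => if_neg fun h => ?_
      have := mem_support_content v x
      rw [mem_words.1 hv, h.1, Finsupp.mem_support_iff] at this
      exact this hm
    · obtain ⟨d, rfl⟩ : ∃ d, c = d + Finsupp.single m 1 :=
        ⟨c - Finsupp.single m 1, (tsub_add_cancel_of_le (by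
          simpa [Finsupp.single_le_iff] using Nat.one_le_iff_ne_zero.2 hm)).symm⟩
      have hd := (support_add_single_subset m.lt_succ_self d).1 hc
      rw [coeff_X_mul_add_single, coeff_wordSeries (n := d.degree + 1) _ hc (by simp),
        coeff_wordSeries _ hd rfl, Finset.mul_sum]
      have h1 := sum_insertNth m d.degree d fun v x =>
        if IsHigh m (d.degree + 1) v x then tokWt s Y m v else (0 : R)
      simp only [markStat, ite_and]
      rw [h1]
      refine Finset.sum_congr rfl fun w hw => ?_
      have h2 : ∀ x : Fin (d.degree + 1),
          (if IsHigh m _ (x.insertNth m w : Fin (d.degree + 1) → ℕ) x then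
            tokWt s Y m (x.insertNth m w : Fin (d.degree + 1) → ℕ) else 0) =
          (if below w m ≤ x then 1 else 0) * tokWt s Y m w := by
        intro x
        rw [IsHigh, below_insertNth x le_rfl]
        split_ifs with h
        · rw [tokWt_insertNth_of_below_le s Y w h, one_mul]
        · rw [zero_mul]
      rw [Finset.sum_congr rfl fun x _ => h2 x, ← Finset.sum_mul]
      congr 1
      have h3 : below w m + d m = d.degree := by
        have h4 := below_of_forall_lt (letter_lt_of_mem_words hd hw)
        rwa [below_succ, ← content_apply, mem_words.1 hw] at h4
      rw [Fin.sum_univ_eq_sum_range (fun x => if below w m ≤ x then (1 : R) else 0),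
        Finset.sum_boole]
      congr 1
      have h4 : (Finset.range (d.degree + 1)).filter (fun x => below w m ≤ x) =
          Finset.Ico (below w m) (d.degree + 1) := by
        ext x
        simp
        omega
      rw [h4, Nat.card_Ico]
      simp
      omega
  · rw [coeff_wordSeries_of_not _ hc]
    by_cases hm : c m = 0
    · simp [hm]
    · obtain ⟨d, rfl⟩ : ∃ d, c = d + Finsupp.single m 1 :=
        ⟨c - Finsupp.single m 1, (tsub_add_cancel_of_le (by
          simpa [Finsupp.single_le_iff] using Nat.one_le_iff_ne_zero.2 hm)).symm⟩
      rw [coeff_X_mul_add_single, coeff_wordSeries_of_not, mul_zero]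
      exact mt (support_add_single_subset m.lt_succ_self d).2 hc

theorem coeff_lowSeries_mul {m : ℕ} {B F G : MvPowerSeries ℕ R} (hB : B ∈ lowSeries R m)
    (h : ∀ c : ℕ →₀ ℕ, MvPowerSeries.coeff c G = c m * MvPowerSeries.coeff c F) (c : ℕ →₀ ℕ) :
    MvPowerSeries.coeff c (B * G) = c m * MvPowerSeries.coeff c (B * F) := by
  classical
  rw [MvPowerSeries.coeff_mul, MvPowerSeries.coeff_mul, Finset.mul_sum]
  refine Finset.sum_congr rfl fun p hp => ?_
  rw [Finset.HasAntidiagonal.mem_antidiagonal] at hp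
  by_cases h1 : p.1.support ⊆ Finset.range m
  · have h2 : p.1 m = 0 := by
      by_contra h2
      simpa using h1 (Finsupp.mem_support_iff.2 h2)
    have h3 : c m = p.2 m := by rw [← hp, Finsupp.add_apply, h2, zero_add]
    rw [h, h3]
    ring
  · rw [hB _ h1]
    ring

theorem permSeries_mem (s Y : R) (m : ℕ) : permSeries s Y m ∈ lowSeries R m :=
  fun _ hc => coeff_wordSeries_of_not _ hc

theorem coeff_tokSeries_of_eq_zero (s Y : R) {m : ℕ} {c : ℕ →₀ ℕ} (hc : c m = 0) :
    MvPowerSeries.coeff c (tokSeries s Y m) = MvPowerSeries.coeff c (permSeries s Y m) := by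
  have h : c.support ⊆ Finset.range (m + 1) ↔ c.support ⊆ Finset.range m := by
    refine ⟨fun h j hj => ?_, fun h => h.trans (Finset.range_subset_range.2 m.le_succ)⟩
    have h1 := h hj
    have h2 : j ≠ m := by
      rintro rfl
      exact Finsupp.mem_support_iff.1 hj hc
    simp at h1 ⊢
    omega
  by_cases hs : c.support ⊆ Finset.range m
  · rw [tokSeries, permSeries, coeff_wordSeries _ (h.2 hs) rfl, coeff_wordSeries _ hs rfl]
    exact Finset.sum_congr rfl fun v hv => tokWt_eq_permWt s Y (letter_lt_of_mem_words hs hv)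
  · rw [tokSeries, permSeries, coeff_wordSeries_of_not _ (mt h.1 hs),
      coeff_wordSeries_of_not _ hs]

theorem tokSeries_mul (hR : ∀ (k : ℕ) (a : R), k ≠ 0 → k * a = 0 → a = 0) (s Y : R) (m : ℕ) :
    (hookDet s m - MvPowerSeries.X m * geomProd s m) * tokSeries s Y m =
      hookDet s m * permSeries s Y m := by
  classical
  ext c
  have h0 : (hookDet s m - MvPowerSeries.X m * geomProd s m) * tokSeries s Y m =
      hookDet s m * tokSeries s Y m - geomProd s m * (MvPowerSeries.X m * tokSeries s Y m) := by
    ring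
  by_cases hc : c m = 0
  · rw [h0, map_sub, mul_left_comm (geomProd s m), coeff_X_mul_of_eq_zero m _ hc, sub_zero,
      MvPowerSeries.coeff_mul, MvPowerSeries.coeff_mul]
    refine Finset.sum_congr rfl fun p hp => ?_
    rw [Finset.HasAntidiagonal.mem_antidiagonal] at hp
    rw [coeff_tokSeries_of_eq_zero]
    have : p.1 m + p.2 m = 0 := by rw [← Finsupp.add_apply, hp, hc]
    omega
  · have h1 := congrArg (MvPowerSeries.coeff c) (hookDet_mul_markSeries s Y (le_refl m))
    rw [coeff_lowSeries_mul (hookDet_mem s m) (coeff_markSeries_isHigh_zero s Y m),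
      coeff_lowSeries_mul (geomProd_mem s m) (coeff_markSeries_isHigh s Y m)] at h1
    have h2 := hR (c m) (MvPowerSeries.coeff c (hookDet s m * tokSeries s Y m) -
      MvPowerSeries.coeff c (geomProd s m * (MvPowerSeries.X m * tokSeries s Y m))) hc
      (by rw [mul_sub, h1, sub_self])
    rw [h0, map_sub, h2]
    refine (Subring.mul_mem _ (hookDet_mem s m) (permSeries_mem s Y m) c fun h => ?_).symm
    simpa using h (Finsupp.mem_support_iff.2 hc)

theorem permWt_insertNth_last (s Y : R) {m n : ℕ} {w : Fin n → ℕ} (h : ∀ y, w y ≤ m) :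
    permWt s Y ((Fin.last n).insertNth m w : Fin (n + 1) → ℕ) = Y * permWt s Y w := by
  rw [permWt, Fin.prod_univ_succAbove _ (Fin.last n), permWt]
  congr 1
  · have : std ((Fin.last n).insertNth m w : Fin (n + 1) → ℕ) (Fin.last n) = n := by
      have h1 : ∀ x, w x < m ∨ w x = m ∧ (Fin.last n).succAbove x < Fin.last n := fun x =>
        (lt_or_eq_of_le (h x)).imp_right fun e =>
          ⟨e, Fin.succAbove_last ▸ Fin.castSucc_lt_last x⟩
      simp only [std, stdLT, Finset.card_filter, Fin.sum_univ_succAbove _ (Fin.last n),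
        Fin.insertNth_apply_same, Fin.insertNth_apply_succAbove, h1, lt_irrefl]
      simp
    rw [this, posWt, Fin.val_last, if_pos rfl]
  · refine Finset.prod_congr rfl fun y _ => ?_
    have : std ((Fin.last n).insertNth m w : Fin (n + 1) → ℕ) ((Fin.last n).succAbove y) =
        std w y := by
      simp only [std, stdLT, Finset.card_filter, Fin.sum_univ_succAbove _ (Fin.last n),
        Fin.insertNth_apply_same, Fin.insertNth_apply_succAbove, not_lt.2 (h y),
        (Fin.le_last _).not_gt, and_false, or_false, if_false, zero_add,
        (Fin.strictMono_succAbove _).lt_iff_lt]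
    rw [this, Fin.succAbove_last, Fin.val_castSucc]

theorem permWt_eq_tokWt (s Y : R) {m n : ℕ} {v : Fin (n + 1) → ℕ} (h : ∀ y, v y ≤ m)
    (hlast : v (Fin.last n) ≠ m) : permWt s Y v = tokWt s Y m v := by
  refine Finset.prod_congr rfl fun y _ => ?_
  split_ifs with hy
  · rfl
  · have hy : v y = m := le_antisymm (h y) (not_lt.1 hy)
    have hyl : y < Fin.last n := Fin.lt_last_iff_ne_last.2 (by rintro rfl; exact hlast hy)
    have h1 : insert (Fin.last n) (Finset.Iio y) ⊆ Finset.univ.filter fun a => stdLT v a y := by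
      intro a ha
      simp only [Finset.mem_insert, Finset.mem_Iio] at ha
      simp only [Finset.mem_filter, Finset.mem_univ, true_and, stdLT, hy]
      rcases ha with rfl | ha
      · exact .inl (lt_of_le_of_ne (h _) hlast)
      · have := h a
        omega
    have h2 := Finset.card_le_card h1
    rw [Finset.card_insert_of_notMem (by simpa using hyl.le), Fin.card_Iio] at h2
    change _ ≤ std v y at h2
    rw [posWt, if_neg (by omega), if_neg (by omega)]

theorem permSeries_succ_mul (s Y : R) (m : ℕ) :
    permSeries s Y (m + 1) * (1 - MvPowerSeries.C Y * MvPowerSeries.X m) =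
      (1 - MvPowerSeries.X m) * tokSeries s Y m := by
  classical
  let δ : ∀ n, (Fin n → ℕ) → R := fun n v => ∑ x : Fin n,
    if v x = m then (if (x : ℕ) + 1 = n ∧ ∀ y, v y ≤ m then
      permWt s Y v + (-1) * tokWt s Y m v else 0) else 0
  have h1 : permSeries s Y (m + 1) = tokSeries s Y m + wordSeries (m + 1) δ := by
    rw [permSeries, tokSeries, ← wordSeries_add]
    refine wordSeries_congr fun n v hv => ?_
    have hv : ∀ y, v y ≤ m := fun y => Nat.lt_succ_iff.1 (hv y)
    cases n with
    | zero => simp [δ, permWt, tokWt]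
    | succ n =>
      have : δ (n + 1) v =
          if v (Fin.last n) = m then permWt s Y v + (-1) * tokWt s Y m v else 0 := by
        simp only [δ]
        rw [Finset.sum_eq_single (Fin.last n)]
        · simp [hv]
        · intro x _ hx
          have : (x : ℕ) ≠ n := fun h => hx (Fin.ext h)
          simp [this]
        · simp
      rw [this]
      split_ifs with h
      · ring
      · rw [permWt_eq_tokWt s Y hv h, add_zero]
  have h2 : wordSeries (m + 1) δ = MvPowerSeries.X m *
      wordSeries (m + 1) fun _ v => Y * permWt s Y v + (-1) * tokWt s Y m v := by
    refine wordSeries_eq_X_mul m.lt_succ_self (fun n v hv => ?_) fun n c hc _ => ?_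
    · exact Finset.sum_eq_zero fun x _ => if_neg (hv x)
    · rw [sum_insertNth m n c fun v x => if (x : ℕ) + 1 = n + 1 ∧ ∀ y, v y ≤ m then
        permWt s Y v + (-1) * tokWt s Y m v else 0]
      refine Finset.sum_congr rfl fun w hw => ?_
      have hw' : ∀ y, w y ≤ m := fun y => Nat.lt_succ_iff.1 (letter_lt_of_mem_words hc hw y)
      rw [Finset.sum_eq_single (Fin.last n)]
      · rw [if_pos, permWt_insertNth_last s Y hw',
          tokWt_insertNth_of_below_le s Y w (by simpa using below_le w m)]
        refine ⟨by simp, fun y => ?_⟩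
        cases y using Fin.lastCases with
        | last => simp
        | cast y =>
          rw [← Fin.succAbove_last, Fin.insertNth_apply_succAbove]
          exact hw' y
      · intro x _ hx
        have : (x : ℕ) ≠ n := fun h => hx (Fin.ext h)
        simp [this]
      · simp
  rw [wordSeries_add, wordSeries_C_mul, wordSeries_C_mul, map_neg, map_one] at h2
  change _ = MvPowerSeries.X m * (_ * permSeries s Y (m + 1) + _ * tokSeries s Y m) at h2
  linear_combination h1 + h2

theorem permSeries_mul_hookDet (hR : ∀ (k : ℕ) (a : R), k ≠ 0 → k * a = 0 → a = 0) (s Y : R)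
    (m : ℕ) : permSeries s Y m * hookDet s m *
      ∏ i ∈ Finset.range m, (1 - MvPowerSeries.C Y * MvPowerSeries.X i) = 1 := by
  induction m with
  | zero =>
    rw [hookDet, Finset.prod_range_zero, mul_one, mul_one, ← wordSeries_nil 0]
    refine wordSeries_congr fun n v hv => ?_
    cases n with
    | zero => simp [permWt]
    | succ n => exact absurd (hv 0) (by omega)
  | succ m ih =>
    rw [Finset.prod_range_succ]
    set Q := ∏ i ∈ Finset.range m, (1 - MvPowerSeries.C Y * MvPowerSeries.X i)
    have h1 := permSeries_succ_mul s Y m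
    have h2 := tokSeries_mul hR s Y m
    have h3 := geomSeries_one_mul (R := R) m
    have h4 : hookDet s (m + 1) =
        geomSeries 1 m * (hookDet s m - MvPowerSeries.X m * geomProd s m) := rfl
    rw [h4]
    set K := hookDet s m - MvPowerSeries.X m * geomProd s m
    linear_combination geomSeries 1 m * K * Q * h1 + Q * K * tokSeries s Y m * h3 + Q * h2 + ih

theorem permSeries_mul_prod (hR : ∀ (k : ℕ) (a : R), k ≠ 0 → k * a = 0 → a = 0) (s Y : R)
    (m : ℕ) : permSeries s Y m *
      ∏ i ∈ Finset.range m, (1 - MvPowerSeries.C Y * MvPowerSeries.X i) = hookSeries s m := by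
  have h1 := permSeries_mul_hookDet hR s Y m
  have h2 := hookSeries_mul_hookDet s m
  linear_combination hookSeries s m * h1 - permSeries s Y m *
    (∏ i ∈ Finset.range m, (1 - MvPowerSeries.C Y * MvPowerSeries.X i)) * h2

end PermSeries

section NilpotentMark

variable {R : Type*} [CommRing R]

theorem prod_one_sub_mul_of_sq_eq_zero {S : Type*} [CommRing S] {a : S} (ha : a * a = 0) (x : ℕ → S)
    (t : Finset ℕ) : (∏ i ∈ t, (1 - a * x i)) * (1 + a * ∑ i ∈ t, x i) = 1 := by
  induction t using Finset.induction_on with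
  | empty => simp
  | insert i t hi ih =>
    rw [Finset.prod_insert hi, Finset.sum_insert hi]
    linear_combination ih - (∏ i ∈ t, (1 - a * x i)) * (x i * x i + x i * ∑ i ∈ t, x i) * ha

theorem sum_consStat {m : ℕ} (φ : List ℕ → R) {l : List ℕ} (hl : l ≠ []) (h : ∀ a ∈ l, a < m) :
    ∑ i ∈ Finset.range m, consStat i φ l = φ l.tail := by
  cases l with
  | nil => exact absurd rfl hl
  | cons a l => simp [consStat, h a]

theorem permWt_eq_pow_mul_pow (s Y : R) {n : ℕ} (v : Fin n → ℕ) :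
    permWt s Y v = Y ^ (Finset.univ.filter fun y : Fin n => std v y = y).card *
      s ^ (Finset.univ.filter fun y : Fin n => std v y < y).card := by
  rw [permWt, ← Finset.prod_const, ← Finset.prod_const, Finset.prod_filter, Finset.prod_filter,
    ← Finset.prod_mul_distrib]
  refine Finset.prod_congr rfl fun y _ => ?_
  rw [posWt]
  rcases lt_trichotomy (std v y) y with h | h | h
  · simp [h, h.ne, h.ne']
  · simp [h]
  · simp [h.ne, h.ne', h.not_gt]

/-- Equidistribution, over the words of given content, of fixed points and excedances of inverse
standardizations with hook weights, up to one fixed point. -/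
theorem sum_permWt_words (hR : ∀ (k : ℕ) (a : R), k ≠ 0 → k * a = 0 → a = 0) (s : R) {ε : R}
    (hε : ε * ε = 0) {n : ℕ} (hn : 0 < n) (c : ℕ →₀ ℕ) :
    ∑ v ∈ words n c, permWt s ε v =
      ∑ v ∈ words n c, (hookWt s (List.ofFn v) + ε * hookWt s (List.ofFn v).tail) := by
  by_cases hc : c.degree = n
  · obtain ⟨m, hm⟩ := c.support.exists_nat_subset_range
    have h1 : permSeries s ε m = wordSeries m fun _ v => hookWt s (List.ofFn v) +
        ε * ∑ i ∈ Finset.range m, consStat i (hookWt s) (List.ofFn v) := by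
      rw [wordSeries_add, wordSeries_C_mul, wordSeries_sum]
      rw [Finset.sum_congr rfl fun i hi => wordSeries_consStat (Finset.mem_range.1 hi) (hookWt s),
        ← Finset.sum_mul]
      have h2 := permSeries_mul_prod hR s ε m
      have h3 : (MvPowerSeries.C ε * MvPowerSeries.C ε : MvPowerSeries ℕ R) = 0 := by
        rw [← map_mul, hε, map_zero]
      have h4 := prod_one_sub_mul_of_sq_eq_zero h3 MvPowerSeries.X (Finset.range m)
      change _ = hookSeries s m + _ * (_ * hookSeries s m)
      linear_combination
        (1 + MvPowerSeries.C ε * ∑ i ∈ Finset.range m, MvPowerSeries.X i) * h2 -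
          permSeries s ε m * h4
    have h2 := congrArg (MvPowerSeries.coeff c) h1
    rw [permSeries, coeff_wordSeries _ hm hc, coeff_wordSeries _ hm hc] at h2
    rw [h2]
    refine Finset.sum_congr rfl fun v hv => ?_
    rw [sum_consStat _ (by simpa using hn.ne')]
    intro a ha
    obtain ⟨y, rfl⟩ := (List.mem_ofFn' _ _).1 ha
    exact letter_lt_of_mem_words hm hv y
  · have : words n c = ∅ := Finset.eq_empty_of_forall_notMem fun v hv =>
      hc (mem_words.1 hv ▸ degree_content v)
    rw [this, Finset.sum_empty, Finset.sum_empty]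

end NilpotentMark

section Permutations

variable {n : ℕ}

theorem below_congr_content {v w : Fin n → ℕ} (h : content v = content w) (i : ℕ) :
    below v i = below w i := by
  induction i with
  | zero => simp [below]
  | succ i ih => rw [below_succ, below_succ, ih, ← content_apply, ← content_apply, h]

/-- A permutation which is increasing on the fibres of `f`. -/
def FibreMono (f : Fin n → ℕ) (σ : Equiv.Perm (Fin n)) : Prop :=
  ∀ a b, a < b → f a = f b → σ a < σ b

theorem std_comp_symm {f : Fin n → ℕ} (hf : Monotone f) {σ : Equiv.Perm (Fin n)}
    (hσ : FibreMono f σ) (y : Fin n) : std (f ∘ ⇑σ.symm) y = (σ.symm y : Fin n) := by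
  have h1 : ∀ a, stdLT (f ∘ ⇑σ.symm) a y ↔ σ.symm a < σ.symm y := by
    intro a
    simp only [stdLT, Function.comp_apply]
    constructor
    · rintro (h | ⟨h, hay⟩)
      · exact hf.reflect_lt h
      · by_contra h'
        rcases (not_lt.1 h').lt_or_eq with h' | h'
        · have := hσ _ _ h' h.symm
          rw [Equiv.apply_symm_apply, Equiv.apply_symm_apply] at this
          exact this.not_gt hay
        · exact hay.ne (σ.symm.injective h').symm
    · intro h
      refine (hf h.le).lt_or_eq.imp_right fun h' => ⟨h', ?_⟩
      simpa using hσ _ _ h h'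
  have h2 : (Finset.univ.filter fun a => stdLT (f ∘ ⇑σ.symm) a y).map σ.symm.toEmbedding =
      Finset.Iio (σ.symm y) := by
    ext a
    simp only [h1, Finset.mem_map_equiv, Finset.mem_filter, Finset.mem_univ, true_and,
      Finset.mem_Iio, Equiv.symm_symm, Equiv.symm_apply_apply]
  rw [std, ← Finset.card_map σ.symm.toEmbedding, h2, Fin.card_Iio]

theorem std_of_monotone {f : Fin n → ℕ} (hf : Monotone f) (y : Fin n) : std f y = y :=
  std_comp_symm hf (σ := 1) (fun _ _ h _ => h) y

/-- The standardization of a word as a permutation. -/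
noncomputable def stdPerm (v : Fin n → ℕ) : Equiv.Perm (Fin n) :=
  Equiv.ofBijective (fun y => ⟨std v y, std_lt v y⟩) (Finite.injective_iff_bijective.1
    fun _ _ h => std_injective v (congrArg Fin.val h))

theorem coe_stdPerm (v : Fin n → ℕ) (y : Fin n) : (stdPerm v y : ℕ) = std v y := rfl

theorem comp_stdPerm {f v : Fin n → ℕ} (hf : Monotone f) (h : content v = content f) :
    f ∘ ⇑(stdPerm v) = v := by
  ext y
  symm
  have h1 := std_of_monotone hf (stdPerm v y)
  rw [coe_stdPerm] at h1
  refine letter_of_std ?_ ?_ <;> rw [below_congr_content h, ← h1]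
  · exact below_le_std le_rfl
  · exact std_lt_below (Nat.lt_succ_self _)

theorem fibreMono_symm_stdPerm {f v : Fin n → ℕ} (hf : Monotone f) (h : content v = content f) :
    FibreMono f (stdPerm v).symm := by
  intro a b hab hfab
  obtain ⟨y, rfl⟩ := (stdPerm v).surjective a
  obtain ⟨z, rfl⟩ := (stdPerm v).surjective b
  have h1 := congrFun (comp_stdPerm hf h)
  simp only [Function.comp_apply] at h1
  rw [h1, h1] at hfab
  rw [Equiv.symm_apply_apply, Equiv.symm_apply_apply]
  have h2 := std_lt_std.1 (show std v y < std v z from hab)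
  exact (h2.resolve_left hfab.not_lt).2

theorem sum_words_content {R : Type*} [CommRing R] {f : Fin n → ℕ} (hf : Monotone f)
    [DecidablePred (FibreMono f)] (F : (Fin n → ℕ) → R) :
    ∑ v ∈ words n (content f), F v =
      ∑ σ ∈ Finset.univ.filter (FibreMono f), F (f ∘ ⇑σ.symm) := by
  refine Finset.sum_nbij' (fun v => (stdPerm v).symm) (fun σ => f ∘ ⇑σ.symm) ?_ ?_ ?_ ?_ ?_
  · intro v hv
    simpa using fibreMono_symm_stdPerm hf (mem_words.1 hv)
  · intro σ _
    exact mem_words.2 (content_comp_equiv f σ.symm)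
  · intro v hv
    simpa using comp_stdPerm hf (mem_words.1 hv)
  · intro σ hσ
    rw [Finset.mem_filter] at hσ
    rw [← Equiv.symm_bijective.injective.eq_iff, Equiv.symm_symm]
    ext y
    exact std_comp_symm hf hσ.2 y
  · intro v hv
    rw [Equiv.symm_symm]
    rw [comp_stdPerm hf (mem_words.1 hv)]

theorem permWt_comp_symm {R : Type*} [CommRing R] (s Y : R) {f : Fin n → ℕ} (hf : Monotone f)
    {σ : Equiv.Perm (Fin n)} (hσ : FibreMono f σ) :
    permWt s Y (f ∘ ⇑σ.symm) = Y ^ (Finset.univ.filter fun a => σ a = a).card *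
      s ^ (Finset.univ.filter fun a => a < σ a).card := by
  rw [permWt_eq_pow_mul_pow]
  congr 2
  · refine Finset.card_equiv σ.symm fun y => ?_
    simp [std_comp_symm hf hσ, Fin.val_inj, eq_comm]
  · refine Finset.card_equiv σ.symm fun y => ?_
    simp [std_comp_symm hf hσ]

/-- The inverse of a permutation in one-line form, read backwards. -/
def revInv (σ : Equiv.Perm (Fin n)) : List (Fin n) := (List.ofFn ⇑σ.symm).reverse

theorem reverse_ofFn_comp (v : Fin n → ℕ) : (List.ofFn v).reverse = List.ofFn (v ∘ Fin.rev) := by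
  refine List.ext_getElem (by simp) fun i h1 h2 => ?_
  simp only [List.getElem_reverse, List.getElem_ofFn, Function.comp_apply, List.length_ofFn]
  congr 1
  ext
  simp [Fin.val_rev]
  omega

theorem sum_words_reverse {R : Type*} [CommRing R] (c : ℕ →₀ ℕ) (H : List ℕ → R) :
    ∑ v ∈ words n c, H (List.ofFn v) = ∑ v ∈ words n c, H (List.ofFn v).reverse := by
  symm
  refine Finset.sum_nbij' (fun v => v ∘ Fin.rev) (fun v => v ∘ Fin.rev) ?_ ?_ ?_ ?_ ?_
  · intro v hv
    rw [mem_words] at hv ⊢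
    rw [← hv, ← content_comp_equiv v Fin.revPerm]
    rfl
  · intro v hv
    rw [mem_words] at hv ⊢
    rw [← hv, ← content_comp_equiv v Fin.revPerm]
    rfl
  · intro v _
    ext
    simp
  · intro v _
    ext
    simp
  · intro v _
    rw [reverse_ofFn_comp]

theorem reverse_ofFn_comp_symm (f : Fin n → ℕ) (σ : Equiv.Perm (Fin n)) :
    (List.ofFn (f ∘ ⇑σ.symm)).reverse = (revInv σ).map f := by
  rw [revInv, List.map_reverse, List.map_ofFn]

theorem pairwise_revInv {f : Fin n → ℕ} (hf : Monotone f) {σ : Equiv.Perm (Fin n)}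
    (hσ : FibreMono f σ) :
    (revInv σ).Pairwise fun a b => f a < f b ↔ (a : ℕ) < b := by
  rw [revInv, List.pairwise_reverse, List.pairwise_ofFn]
  intro y z hyz
  refine ⟨fun h => hf.reflect_lt h, fun h => lt_of_le_of_ne (hf (le_of_lt h)) fun h' => ?_⟩
  have := hσ _ _ h h'
  simp only [Equiv.apply_symm_apply] at this
  exact this.not_gt hyz

theorem sum_fibreMono {R : Type*} [CommRing R]
    (hR : ∀ (k : ℕ) (a : R), k ≠ 0 → k * a = 0 → a = 0) (s : R) {ε : R} (hε : ε * ε = 0)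
    (hn : 0 < n) {f : Fin n → ℕ} (hf : Monotone f) [DecidablePred (FibreMono f)] :
    ∑ σ ∈ Finset.univ.filter (FibreMono f),
        ε ^ (Finset.univ.filter fun a => σ a = a).card *
          s ^ (Finset.univ.filter fun a => a < σ a).card =
      ∑ σ ∈ Finset.univ.filter (FibreMono f), (hookWt s ((revInv σ).map (↑)) +
        ε * hookWt s ((revInv σ).tail.map (↑))) := by
  have h1 := sum_permWt_words hR s hε hn (content f)
  rw [sum_words_reverse (content f) fun l => hookWt s l + ε * hookWt s l.tail,
    sum_words_content hf, sum_words_content hf] at h1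
  calc _ = ∑ σ ∈ Finset.univ.filter (FibreMono f), permWt s ε (f ∘ ⇑σ.symm) :=
        Finset.sum_congr rfl fun σ hσ =>
          (permWt_comp_symm s ε hf (Finset.mem_filter.1 hσ).2).symm
    _ = _ := h1
    _ = _ := by
        refine Finset.sum_congr rfl fun σ hσ => ?_
        have h2 := pairwise_revInv hf (Finset.mem_filter.1 hσ).2
        rw [reverse_ofFn_comp_symm, ← List.map_tail, hookWt_map s f _ _ h2,
          hookWt_map s f _ _ h2.tail]

end Permutations

section Descents

variable {n : ℕ}

theorem permToFun_succ (σ : Equiv.Perm (Fin n)) (a : Fin n) :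
    permToFun σ (a + 1) = (σ a : ℕ) + 1 := by
  rw [permToFun, dif_pos ⟨by omega, a.isLt⟩]
  simp

theorem card_filter_Icc (p : ℕ → Prop) [DecidablePred p] :
    ((Finset.Icc 1 n).filter p).card = (Finset.univ.filter fun a : Fin n => p (a + 1)).card := by
  symm
  refine Finset.card_nbij (fun a => (a : ℕ) + 1) ?_ ?_ ?_
  · intro a ha
    simp at ha ⊢
    exact ha
  · intro a _ b _ h
    simpa [Fin.val_inj] using h
  · intro i hi
    simp only [Finset.coe_filter, Finset.mem_Icc, Set.mem_ofPred_eq] at hi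
    have h1 : i - 1 + 1 = i := by omega
    exact ⟨⟨i - 1, by omega⟩, by simpa [h1] using hi.2, h1⟩

theorem fixCount_eq (σ : Equiv.Perm (Fin n)) :
    fixCount σ = (Finset.univ.filter fun a => σ a = a).card := by
  rw [fixCount, card_filter_Icc]
  simp [permToFun_succ, Fin.val_inj]

theorem excCount_eq (σ : Equiv.Perm (Fin n)) :
    excCount σ = (Finset.univ.filter fun a => a < σ a).card := by
  rw [excCount, card_filter_Icc]
  simp [permToFun_succ]

theorem succ_mem_desSet {σ : Equiv.Perm (Fin n)} {k : ℕ} (hk : k + 1 < n) :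
    k + 1 ∈ desSet σ ↔ σ ⟨k + 1, hk⟩ < σ ⟨k, by omega⟩ := by
  have h1 := permToFun_succ σ ⟨k + 1, hk⟩
  have h2 := permToFun_succ σ ⟨k, by omega⟩
  simp only at h1 h2
  rw [desSet, Finset.mem_filter, h1, h2, Finset.mem_Icc, Fin.lt_def]
  omega

/-- The weakly increasing word rising exactly at the elements of `I`. -/
def stepWord (n : ℕ) (I : Finset ℕ) (a : Fin n) : ℕ := (I.filter (· ≤ (a : ℕ))).card

theorem stepWord_monotone (I : Finset ℕ) : Monotone (stepWord n I) := fun _ _ h =>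
  Finset.card_le_card (Finset.monotone_filter_right I fun _ _ hi => hi.trans h)

theorem stepWord_eq_iff (I : Finset ℕ) {a b : Fin n} (h : a ≤ b) :
    stepWord n I a = stepWord n I b ↔ ∀ i ∈ I, ¬ ((a : ℕ) < i ∧ i ≤ b) := by
  have h1 : I.filter (· ≤ (a : ℕ)) ⊆ I.filter (· ≤ (b : ℕ)) :=
    Finset.monotone_filter_right I fun _ _ hi => hi.trans h
  constructor
  · intro heq i hi hab
    have h2 := Finset.eq_of_subset_of_card_le h1 heq.ge
    have h3 : i ∈ I.filter (· ≤ (a : ℕ)) := h2 ▸ Finset.mem_filter.2 ⟨hi, hab.2⟩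
    exact absurd (Finset.mem_filter.1 h3).2 (by omega)
  · intro hI
    refine congrArg Finset.card (Finset.filter_congr fun i hi => ?_)
    have := hI i hi
    have h : (a : ℕ) ≤ b := h
    omega

theorem fibreMono_stepWord_iff {σ : Equiv.Perm (Fin n)} {I : Finset ℕ} :
    FibreMono (stepWord n I) σ ↔ desSet σ ⊆ I := by
  constructor
  · intro h i hi
    by_contra hiI
    have h1 := Finset.mem_Icc.1 (Finset.mem_filter.1 hi).1
    obtain ⟨k, rfl⟩ : ∃ k, i = k + 1 := ⟨i - 1, by omega⟩
    have hk : k + 1 < n := by omega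
    refine ((succ_mem_desSet hk).1 hi).not_gt (h ⟨k, by omega⟩ ⟨k + 1, hk⟩ (by simp) ?_)
    rw [stepWord_eq_iff I (by simp)]
    intro i hi h2
    simp only at h2
    exact hiI ((show i = k + 1 by omega) ▸ hi)
  · intro h a b hab hf
    rw [stepWord_eq_iff I hab.le] at hf
    obtain ⟨d, hd⟩ : ∃ d, (b : ℕ) = a + d + 1 := ⟨b - a - 1, by omega⟩
    induction d generalizing b with
    | zero =>
      obtain ⟨k, hk⟩ := a
      obtain ⟨l, hl⟩ := b
      simp only at hd
      subst hd
      have h1 := mt (@h _) fun h' => hf _ h' ⟨by simp, le_rfl⟩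
      have h2 := (mt (succ_mem_desSet hl).2 h1)
      exact lt_of_le_of_ne (not_lt.1 h2) fun h' => by simpa using σ.injective h'
    | succ d ih =>
      obtain ⟨l, hl⟩ := b
      simp only at hd
      subst hd
      refine (ih ⟨a + d + 1, by omega⟩ (by simp [Fin.lt_def]) (fun i hi h' => ?_)
        rfl).trans ?_
      · refine hf i hi ⟨h'.1, h'.2.trans ?_⟩
        simp only
        omega
      · have h1 := mt (@h _) fun h' => hf _ h' ⟨by simp only; omega, le_rfl⟩
        have h2 := (mt (succ_mem_desSet hl).2 h1)
        exact lt_of_le_of_ne (not_lt.1 h2) fun h' => by simpa using σ.injective h'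

theorem sum_eq_of_sum_subset {α R : Type*} [Fintype α] [AddCommGroup R] (d : α → Finset ℕ)
    {F G : α → R} (h : ∀ I, ∑ x ∈ Finset.univ.filter (d · ⊆ I), F x =
      ∑ x ∈ Finset.univ.filter (d · ⊆ I), G x) (J : Finset ℕ) :
    ∑ x ∈ Finset.univ.filter (d · = J), F x = ∑ x ∈ Finset.univ.filter (d · = J), G x := by
  have key : ∀ (H : α → R) (I : Finset ℕ), ∑ x ∈ Finset.univ.filter (d · ⊆ I), H x =
      ∑ x ∈ Finset.univ.filter (d · = I), H x +
        ∑ K ∈ I.ssubsets, ∑ x ∈ Finset.univ.filter (d · = K), H x := by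
    intro H I
    rw [← Finset.sum_fiberwise_of_maps_to (t := I.powerset) (g := d)
      (fun x hx => Finset.mem_powerset.2 (Finset.mem_filter.1 hx).2),
      Finset.ssubsets, ← Finset.add_sum_erase _ _ (Finset.mem_powerset_self I)]
    have h1 : ∀ K ⊆ I, (Finset.univ.filter (d · ⊆ I)).filter (d · = K) =
        Finset.univ.filter (d · = K) := by
      intro K hK
      ext x
      simp only [Finset.mem_filter, Finset.mem_univ, true_and]
      exact ⟨fun h => h.2, fun h => ⟨h ▸ hK, h⟩⟩
    rw [h1 I Finset.Subset.rfl]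
    congr 1
    exact Finset.sum_congr rfl fun K hK => by
      rw [h1 K (Finset.mem_powerset.1 (Finset.mem_of_mem_erase hK))]
  induction J using Finset.strongInduction with
  | H J ih =>
    have h1 := h J
    rw [key F, key G, Finset.sum_congr rfl fun K hK => ih K (Finset.mem_ssubsets.1 hK)] at h1
    exact add_right_cancel h1

theorem sum_desSet_eq {R : Type*} [CommRing R]
    (hR : ∀ (k : ℕ) (a : R), k ≠ 0 → k * a = 0 → a = 0) (s : R) {ε : R} (hε : ε * ε = 0)
    (hn : 0 < n) (J : Finset ℕ) :
    ∑ σ : Equiv.Perm (Fin n) with desSet σ = J, ε ^ fixCount σ * s ^ excCount σ =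
      ∑ σ : Equiv.Perm (Fin n) with desSet σ = J, (hookWt s ((revInv σ).map (↑)) +
        ε * hookWt s ((revInv σ).tail.map (↑))) := by
  classical
  refine sum_eq_of_sum_subset _ (fun I => ?_) J
  have h1 := sum_fibreMono hR s hε hn (stepWord_monotone (n := n) I)
  simp only [fibreMono_stepWord_iff] at h1
  simpa only [fixCount_eq, excCount_eq] using h1

theorem desSet_eq_of_strictAnti {σ : Equiv.Perm (Fin n)} (h : StrictAnti σ) :
    desSet σ = Finset.Icc 1 (n - 1) := by
  refine Finset.filter_true_of_mem fun i hi => ?_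
  rw [Finset.mem_Icc] at hi
  obtain ⟨k, rfl⟩ : ∃ k, i = k + 1 := ⟨i - 1, by omega⟩
  exact (Finset.mem_filter.1 ((succ_mem_desSet (by omega)).2
    (h (Fin.mk_lt_mk.2 k.lt_succ_self)))).2

theorem not_isChain_revInv {σ : Equiv.Perm (Fin n)} (h : desSet σ ≠ Finset.Icc 1 (n - 1)) :
    ¬ ((revInv σ).map (fun a : Fin n => (a : ℕ))).IsChain (· < ·) := by
  intro h1
  rw [List.isChain_iff_pairwise, List.pairwise_map, revInv, List.pairwise_reverse,
    List.pairwise_ofFn] at h1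
  refine h (desSet_eq_of_strictAnti fun a b hab => ?_)
  by_contra h2
  rcases (not_lt.1 h2).lt_or_eq with h2 | h2
  · have := h1 h2
    simp only [Equiv.symm_apply_apply] at this
    exact this.not_gt hab
  · exact hab.ne (σ.injective h2)

end Descents

section Dual

open Polynomial

theorem hookWt_map_ringHom {R S : Type*} [CommRing R] [CommRing S] (φ : R →+* S) (s : R) :
    ∀ l, hookWt (φ s) l = φ (hookWt s l)
  | [] => by simp [hookWt]
  | [_] => by simp [hookWt]
  | z :: z' :: l => by
    rw [hookWt, hookWt, hookWt_map_ringHom φ s l, hookWt_map_ringHom φ s (z' :: l)]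
    split_ifs <;> simp

theorem dualNumber_eq_zero_of_natCast_mul (k : ℕ) (a : DualNumber ℤ[X]) (hk : k ≠ 0)
    (h : k * a = 0) : a = 0 := by
  rw [← nsmul_eq_mul] at h
  have hk' : (k : ℤ[X]) ≠ 0 := Nat.cast_ne_zero.2 hk
  refine TrivSqZeroExt.ext ?_ ?_
  · simpa [hk] using congrArg TrivSqZeroExt.fst h
  · simpa [hk] using congrArg TrivSqZeroExt.snd h

theorem eps_pow_mul_inl (k : ℕ) (a : ℤ[X]) :
    (DualNumber.eps : DualNumber ℤ[X]) ^ k * TrivSqZeroExt.inl a =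
      TrivSqZeroExt.inl (if k = 0 then a else 0) + TrivSqZeroExt.inr (if k = 1 then a else 0) := by
  match k with
  | 0 => simp
  | 1 => ext <;> simp
  | k + 2 => simp [pow_add, pow_two]

theorem sum_desSet_sub {n : ℕ} (hn : 0 < n) (J : Finset ℕ) :
    (∑ σ : Equiv.Perm (Fin n) with desSet σ = J ∧ fixCount σ = 0, (X : ℤ[X]) ^ excCount σ) -
      ∑ σ : Equiv.Perm (Fin n) with desSet σ = J ∧ fixCount σ = 1, (X : ℤ[X]) ^ excCount σ =
    ∑ σ : Equiv.Perm (Fin n) with desSet σ = J,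
      (hookWt (X : ℤ[X]) ((revInv σ).map (↑)) - hookWt X ((revInv σ).tail.map (↑))) := by
  have h := sum_desSet_eq dualNumber_eq_zero_of_natCast_mul
    (TrivSqZeroExt.inlHom ℤ[X] ℤ[X] X) DualNumber.eps_mul_eps hn J
  simp only [← map_pow, hookWt_map_ringHom] at h
  simp only [TrivSqZeroExt.inlHom_apply, eps_pow_mul_inl] at h
  have h0 := congrArg TrivSqZeroExt.fst h
  have h1 := congrArg TrivSqZeroExt.snd h
  simp only [TrivSqZeroExt.fst_sum, TrivSqZeroExt.snd_sum, TrivSqZeroExt.fst_add,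
    TrivSqZeroExt.snd_add, TrivSqZeroExt.fst_inl, TrivSqZeroExt.snd_inl, TrivSqZeroExt.fst_inr,
    TrivSqZeroExt.snd_inr, TrivSqZeroExt.fst_mul, TrivSqZeroExt.snd_mul, DualNumber.fst_eps,
    DualNumber.snd_eps, zero_mul, add_zero, zero_add, op_smul_eq_smul, smul_eq_mul,
    mul_one] at h0 h1
  rw [Finset.sum_sub_distrib, ← h0, ← h1, ← Finset.filter_filter, ← Finset.filter_filter,
    Finset.sum_filter (fun σ => fixCount σ = 0), Finset.sum_filter (fun σ => fixCount σ = 1)]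

end Dual

theorem exists_nonneg_mul_of_not_isChain {l : List ℕ} (hl : l ≠ []) (h : ¬ l.IsChain (· < ·)) :
    ∃ Q : Polynomial ℤ, (∀ i, 0 ≤ Q.coeff i) ∧
      hookWt (Polynomial.X : Polynomial ℤ) l - hookWt Polynomial.X l.tail =
        (Polynomial.X - 1) * Q := by
  obtain ⟨z, l, rfl⟩ := List.exists_cons_of_ne_nil hl
  rw [List.tail_cons]
  obtain ⟨h1, h2⟩ | ⟨a, b, h1, h2⟩ := hookWt_cons_eq_pow (Polynomial.X : Polynomial ℤ) z l h
  · exact ⟨0, by simp, by rw [h1, h2]; ring⟩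
  · refine ⟨∑ i ∈ Finset.range a, Polynomial.X ^ (i + b), fun i => ?_, ?_⟩
    · rw [Polynomial.finsetSum_coeff]
      refine Finset.sum_nonneg fun j _ => ?_
      rw [Polynomial.coeff_X_pow]
      split_ifs <;> simp
    · simp only [pow_add, h1, h2, ← Finset.sum_mul]
      rw [← mul_assoc, mul_geom_sum, sub_mul, one_mul]

/-- For a proper subset `J ⊂ [n-1]`, the difference of the excedance
generating polynomials of derangements with descent set `J` and of permutations with
exactly one fixed point and descent set `J` is `(s-1)·Q(s)` for a polynomial `Q` with
nonnegative integer coefficients. -/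
theorem exc_poly_derangement_sub_oneFix (n : ℕ) (hn : 0 < n) (J : Finset ℕ)
    (hJ : J ⊂ Finset.Icc 1 (n - 1)) :
    ∃ Q : Polynomial ℤ, (∀ i, 0 ≤ Q.coeff i) ∧
      (∑ σ ∈ Finset.univ.filter
          (fun σ : Equiv.Perm (Fin n) => desSet σ = J ∧ fixCount σ = 0),
          (Polynomial.X : Polynomial ℤ) ^ excCount σ)
        - (∑ σ ∈ Finset.univ.filter
            (fun σ : Equiv.Perm (Fin n) => desSet σ = J ∧ fixCount σ = 1),
            (Polynomial.X : Polynomial ℤ) ^ excCount σ)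
        = (Polynomial.X - 1) * Q := by
  have h : ∀ σ : Equiv.Perm (Fin n), ∃ Q : Polynomial ℤ, (∀ i, 0 ≤ Q.coeff i) ∧
      (desSet σ = J → hookWt (Polynomial.X : Polynomial ℤ) ((revInv σ).map (↑)) -
        hookWt Polynomial.X ((revInv σ).tail.map (↑)) = (Polynomial.X - 1) * Q) := by
    intro σ
    by_cases hσ : desSet σ = J
    · obtain ⟨Q, hQ, h⟩ := exists_nonneg_mul_of_not_isChain (by simpa [revInv] using hn.ne')
        (not_isChain_revInv (σ := σ) (hσ ▸ hJ.ne))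
      exact ⟨Q, hQ, fun _ => by rw [← h, List.map_tail]⟩
    · exact ⟨0, by simp, fun h => absurd h hσ⟩
  choose Q hQ h using h
  refine ⟨∑ σ with desSet σ = J, Q σ, fun i => ?_, ?_⟩
  · rw [Polynomial.finsetSum_coeff]
    exact Finset.sum_nonneg fun σ _ => hQ σ i
  · rw [sum_desSet_sub hn J, Finset.mul_sum]
    exact Finset.sum_congr rfl fun σ hσ => h σ (Finset.mem_filter.1 hσ).2
end

section
/- Let n be a positive integer and J a subset of [n−1]. Let F'_n(J) be the set of permutations σ of [n] with DEZ σ = J and fix σ = n − |J|, and let G(J) be the set of derangements τ of the set J such that τ(i) > τ(i+1) whenever both i and i+1 belong to J. Then for every nonnegative integer m, #{σ ∈ F'_n(J) : exc σ = m} = #{τ ∈ G(J) : exc τ = m}; equivalently, Σ_{σ∈F'_n(J)} s^{exc σ} = Σ_{τ∈G(J)} s^{exc τ} as polynomials in s. -/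
/-- The word `σ⁰`, where each fixed point value is replaced by `0` (1-based positions). -/
def zeroWord {n : ℕ} (σ : Equiv.Perm (Fin n)) (i : ℕ) : ℕ :=
  if permToFun σ i = i then 0 else permToFun σ i

/-- `DEZ σ = DES σ⁰`, a subset of `[n-1]`. -/
def dezSet {n : ℕ} (σ : Equiv.Perm (Fin n)) : Finset ℕ :=
  (Finset.Icc 1 (n - 1)).filter fun i => zeroWord σ (i + 1) < zeroWord σ i

/-- `exc τ` for a bijection `τ` of a finite set `J` of positive integers. -/
def excOn (J : Finset ℕ) (τ : Equiv.Perm {x // x ∈ J}) : ℕ :=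
  (Finset.univ.filter fun j : {x // x ∈ J} => (j : ℕ) < (τ j : ℕ)).card

/-- The identification of a set `J ⊆ [n-1]` with the corresponding positions in `Fin n`. -/
def positionEquiv (n : ℕ) (J : Finset ℕ) (hJ : J ⊆ Finset.Icc 1 (n - 1)) :
    {x // x ∈ J} ≃ {a : Fin n // (a : ℕ) + 1 ∈ J} where
  toFun x := ⟨⟨(x : ℕ) - 1, by have := Finset.mem_Icc.1 (hJ x.2); omega⟩, by
    have := Finset.mem_Icc.1 (hJ x.2)
    simp only [Nat.sub_add_cancel this.1, x.2]⟩
  invFun a := ⟨(a : Fin n) + 1, a.2⟩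
  left_inv x := Subtype.ext (Nat.sub_add_cancel (Finset.mem_Icc.1 (hJ x.2)).1)
  right_inv a := Subtype.ext (Fin.ext (Nat.add_sub_cancel _ 1))

/-- Permutations of `J` correspond to permutations of `[n]` fixing every point outside `J`. -/
def extendPerm (n : ℕ) (J : Finset ℕ) (hJ : J ⊆ Finset.Icc 1 (n - 1)) :
    Equiv.Perm {x // x ∈ J} ≃
      {σ : Equiv.Perm (Fin n) // ∀ a : Fin n, ¬ (a : ℕ) + 1 ∈ J → σ a = a} :=
  (positionEquiv n J hJ).permCongr.trans
    (Equiv.Perm.subtypeEquivSubtypePerm fun a : Fin n => (a : ℕ) + 1 ∈ J)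

theorem permToFun_add_one {n : ℕ} (σ : Equiv.Perm (Fin n)) (a : Fin n) :
    permToFun σ (a + 1) = σ a + 1 := by
  simp [permToFun]

theorem permToFun_extendPerm_of_notMem {n : ℕ} {J : Finset ℕ} (hJ : J ⊆ Finset.Icc 1 (n - 1))
    (τ : Equiv.Perm {x // x ∈ J}) {i : ℕ} (hi : i ∉ J) :
    permToFun (extendPerm n J hJ τ : Equiv.Perm (Fin n)) i = i := by
  by_cases h : 1 ≤ i ∧ i ≤ n
  · obtain ⟨k, rfl⟩ : ∃ k, i = k + 1 := ⟨i - 1, by omega⟩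
    rw [permToFun_add_one _ ⟨k, by omega⟩, (extendPerm n J hJ τ).2 ⟨k, by omega⟩ hi]
  · simp [permToFun, h]

theorem permToFun_extendPerm_of_mem {n : ℕ} {J : Finset ℕ} (hJ : J ⊆ Finset.Icc 1 (n - 1))
    (τ : Equiv.Perm {x // x ∈ J}) {i : ℕ} (hi : i ∈ J) :
    permToFun (extendPerm n J hJ τ : Equiv.Perm (Fin n)) i = τ ⟨i, hi⟩ := by
  have h := Finset.mem_Icc.1 (hJ hi)
  obtain ⟨k, rfl⟩ : ∃ k, i = k + 1 := ⟨i - 1, by omega⟩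
  have hk : k < n := by omega
  have key : (extendPerm n J hJ τ : Equiv.Perm (Fin n)) ⟨k, hk⟩ =
      positionEquiv n J hJ (τ ⟨k + 1, hi⟩) :=
    Equiv.Perm.ofSubtype_apply_of_mem
      ((positionEquiv n J hJ).permCongr τ) (a := (⟨k, hk⟩ : Fin n)) hi
  rw [permToFun_add_one _ ⟨k, hk⟩, key]
  exact Nat.sub_add_cancel (Finset.mem_Icc.1 (hJ (τ ⟨k + 1, hi⟩).2)).1

theorem permToFun_ne_of_mem_dezSet {n : ℕ} {σ : Equiv.Perm (Fin n)} {i : ℕ}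
    (hi : i ∈ dezSet σ) : permToFun σ i ≠ i := by
  intro h
  have hlt : zeroWord σ (i + 1) < zeroWord σ i := (Finset.mem_filter.1 hi).2
  rw [zeroWord.eq_def σ i, if_pos h] at hlt
  exact Nat.not_lt_zero _ hlt

/-- If there are as many non-fixed points as elements of `DEZ σ`, then `DEZ σ` is exactly the set
of non-fixed points. -/
theorem mem_dezSet_iff_of_fixCount {n : ℕ} {σ : Equiv.Perm (Fin n)}
    (h : fixCount σ = n - (dezSet σ).card) (i : ℕ) :
    i ∈ dezSet σ ↔ permToFun σ i ≠ i := by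
  have hsub : dezSet σ ⊆ (Finset.Icc 1 n).filter fun i => ¬ permToFun σ i = i := by
    intro j hj
    have hj' := Finset.mem_Icc.1 (Finset.mem_filter.1 hj).1
    simp only [Finset.mem_filter, Finset.mem_Icc]
    exact ⟨by omega, permToFun_ne_of_mem_dezSet hj⟩
  have hcard := Finset.card_filter_add_card_filter_not (s := Finset.Icc 1 n)
    (fun i => permToFun σ i = i)
  have hle := Finset.card_le_card hsub
  rw [Nat.card_Icc] at hcard
  unfold fixCount at h
  have heq := Finset.eq_of_subset_of_card_le hsub (by omega)
  constructor
  · exact permToFun_ne_of_mem_dezSet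
  · intro hne
    rw [heq, Finset.mem_filter, Finset.mem_Icc]
    refine ⟨?_, hne⟩
    by_contra hi
    exact hne (by simp [permToFun, hi])

theorem excCount_extendPerm {n : ℕ} {J : Finset ℕ} (hJ : J ⊆ Finset.Icc 1 (n - 1))
    (τ : Equiv.Perm {x // x ∈ J}) :
    excCount (extendPerm n J hJ τ : Equiv.Perm (Fin n)) = excOn J τ := by
  symm
  refine Finset.card_bij (fun j _ => (j : ℕ)) ?_ (fun _ _ _ _ h => Subtype.ext h) ?_
  · rintro ⟨j, hj⟩ h
    have hj' := Finset.mem_Icc.1 (hJ hj)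
    rw [Finset.mem_filter, Finset.mem_Icc, permToFun_extendPerm_of_mem hJ τ hj]
    exact ⟨by dsimp only; omega, (Finset.mem_filter.1 h).2⟩
  · intro i hi
    have hlt := (Finset.mem_filter.1 hi).2
    by_cases h : i ∈ J
    · rw [permToFun_extendPerm_of_mem hJ τ h] at hlt
      exact ⟨⟨i, h⟩, Finset.mem_filter.2 ⟨Finset.mem_univ _, hlt⟩, rfl⟩
    · rw [permToFun_extendPerm_of_notMem hJ τ h] at hlt
      exact absurd hlt (lt_irrefl i)

theorem fixCount_extendPerm {n : ℕ} {J : Finset ℕ} (hJ : J ⊆ Finset.Icc 1 (n - 1))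
    {τ : Equiv.Perm {x // x ∈ J}} (hτ : ∀ j, τ j ≠ j) :
    fixCount (extendPerm n J hJ τ : Equiv.Perm (Fin n)) = n - J.card := by
  have hsub : J ⊆ Finset.Icc 1 n := hJ.trans (Finset.Icc_subset_Icc_right (Nat.sub_le n 1))
  have hfix : (Finset.Icc 1 n).filter
      (fun i => permToFun (extendPerm n J hJ τ : Equiv.Perm (Fin n)) i = i) =
      Finset.Icc 1 n \ J := by
    ext i
    rw [Finset.mem_filter, Finset.mem_sdiff]
    refine and_congr_right fun _ => ?_
    by_cases h : i ∈ J
    · rw [permToFun_extendPerm_of_mem hJ τ h]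
      exact iff_of_false (fun e => hτ ⟨i, h⟩ (Subtype.ext e)) (fun hn => hn h)
    · exact iff_of_true (permToFun_extendPerm_of_notMem hJ τ h) h
  rw [fixCount, hfix, Finset.card_sdiff_of_subset hsub, Nat.card_Icc, Nat.add_sub_cancel]

theorem dezSet_extendPerm_eq_iff {n : ℕ} {J : Finset ℕ} (hJ : J ⊆ Finset.Icc 1 (n - 1))
    {τ : Equiv.Perm {x // x ∈ J}} (hτ : ∀ j, τ j ≠ j) :
    dezSet (extendPerm n J hJ τ : Equiv.Perm (Fin n)) = J ↔
      ∀ (i : ℕ) (hi : i ∈ J) (hi1 : i + 1 ∈ J),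
        (τ ⟨i + 1, hi1⟩ : ℕ) < (τ ⟨i, hi⟩ : ℕ) := by
  have hmem : ∀ (i : ℕ) (hi : i ∈ J),
      zeroWord (extendPerm n J hJ τ : Equiv.Perm (Fin n)) i = τ ⟨i, hi⟩ := fun i hi => by
    rw [zeroWord, permToFun_extendPerm_of_mem hJ τ hi,
      if_neg fun e => hτ ⟨i, hi⟩ (Subtype.ext e)]
  have hnot : ∀ i ∉ J, zeroWord (extendPerm n J hJ τ : Equiv.Perm (Fin n)) i = 0 :=
    fun i hi => if_pos (permToFun_extendPerm_of_notMem hJ τ hi)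
  constructor
  · intro h i hi hi1
    have hd := (Finset.mem_filter.1 (h.symm ▸ hi)).2
    rwa [hmem i hi, hmem (i + 1) hi1] at hd
  · intro h
    ext i
    rw [dezSet, Finset.mem_filter]
    by_cases hi : i ∈ J
    · refine iff_of_true ⟨hJ hi, ?_⟩ hi
      rw [hmem i hi]
      by_cases hi1 : i + 1 ∈ J
      · rw [hmem (i + 1) hi1]
        exact h i hi hi1
      · rw [hnot (i + 1) hi1]
        exact (Finset.mem_Icc.1 (hJ (τ ⟨i, hi⟩).2)).1
    · refine iff_of_false (fun hd => ?_) hi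
      rw [hnot i hi] at hd
      exact Nat.not_lt_zero _ hd.2

/-- For `J ⊆ [n-1]`, let `F'_n(J)` be the permutations of `[n]` with
`DEZ σ = J` and `fix σ = n - |J|`, and let `G(J)` be the derangements `τ` of the set `J`
with `τ(i) > τ(i+1)` whenever `i, i+1 ∈ J`.  Then for every `m`, the number of elements
of `F'_n(J)` with `m` excedances equals the number of elements of `G(J)` with `m`
excedances. -/
theorem card_F'_eq_card_G (n : ℕ) (hn : 0 < n) (J : Finset ℕ)
    (hJ : J ⊆ Finset.Icc 1 (n - 1)) (m : ℕ) :
    Nat.card {σ : Equiv.Perm (Fin n) //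
        dezSet σ = J ∧ fixCount σ = n - J.card ∧ excCount σ = m}
      = Nat.card {τ : Equiv.Perm {x // x ∈ J} //
          (∀ j, τ j ≠ j) ∧
          (∀ (i : ℕ) (hi : i ∈ J) (hi1 : i + 1 ∈ J),
            (τ ⟨i + 1, hi1⟩ : ℕ) < (τ ⟨i, hi⟩ : ℕ)) ∧
          excOn J τ = m} := by
  symm
  refine Nat.card_congr (Equiv.ofBijective
    (fun τ => ⟨(extendPerm n J hJ τ.1).1, (dezSet_extendPerm_eq_iff hJ τ.2.1).2 τ.2.2.1,
      fixCount_extendPerm hJ τ.2.1, (excCount_extendPerm hJ τ.1).trans τ.2.2.2⟩) ⟨?_, ?_⟩)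
  · intro τ τ' h
    rw [Subtype.mk.injEq] at h
    exact Subtype.ext ((extendPerm n J hJ).injective (Subtype.ext h))
  · rintro ⟨σ, hdez, hfix, hexc⟩
    have hiff : ∀ i, i ∈ J ↔ permToFun σ i ≠ i := fun i => by
      rw [← mem_dezSet_iff_of_fixCount (by rw [hdez, hfix]), hdez]
    have hσ : ∀ a : Fin n, ¬ (a : ℕ) + 1 ∈ J → σ a = a := fun a ha => by
      rw [hiff, not_not, permToFun_add_one] at ha
      exact Fin.ext (Nat.succ_injective ha)
    obtain ⟨τ, hτ⟩ := (extendPerm n J hJ).surjective ⟨σ, hσ⟩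
    obtain rfl : (extendPerm n J hJ τ).1 = σ := congrArg Subtype.val hτ
    have hder : ∀ j, τ j ≠ j := fun j e => by
      have hne := (hiff j).1 j.2
      rw [permToFun_extendPerm_of_mem hJ τ j.2] at hne
      exact hne (congrArg Subtype.val e)
    exact ⟨⟨τ, hder, (dezSet_extendPerm_eq_iff hJ hder).1 hdez,
      (excCount_extendPerm hJ τ).symm.trans hexc⟩, rfl⟩
end
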